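/- arXiv:1007.0804 — 3 statements merged into one kernel-verified Lean document; each statement's English description precedes it below -/
import Mathlib

section
/- For every tree T on at least 3 vertices, the overlap number φ(T) equals the number of vertices in the skeleton of T, where the skeleton is a largest subtree in which the neighbor of every leaf has degree 2. -/
/-- An overlap representation of `G`: vertices are adjacent iff their assigned
finite sets intersect and neither is contained in the other. -/
def IsOverlapRep {V : Type*} (G : SimpleGraph V) (f : V → Finset ℕ) : Prop :=
  ∀ u v : V, u ≠ v →
    (G.Adj u v ↔ ((f u ∩ f v).Nonempty ∧ ¬ f u ⊆ f v ∧ ¬ f v ⊆ f u))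

/-- A pure overlap representation: adjacency iff intersection, and no assigned
set contains another. -/
def IsPureOverlapRep {V : Type*} (G : SimpleGraph V) (f : V → Finset ℕ) : Prop :=
  (∀ u v : V, u ≠ v → (G.Adj u v ↔ (f u ∩ f v).Nonempty)) ∧
  (∀ u v : V, u ≠ v → ¬ f u ⊆ f v)

/-- The size of a representation: cardinality of the union of the assigned sets. -/
noncomputable def repSize {V : Type*} (f : V → Finset ℕ) : ℕ :=
  (⋃ v, (f v : Set ℕ)).ncard

/-- The overlap number of `G`. -/
noncomputable def overlapNumber {V : Type*} (G : SimpleGraph V) : ℕ :=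
  sInf {n | ∃ f : V → Finset ℕ, IsOverlapRep G f ∧ repSize f = n}

/-- The pure overlap number of `G`. -/
noncomputable def pureOverlapNumber {V : Type*} (G : SimpleGraph V) : ℕ :=
  sInf {n | ∃ f : V → Finset ℕ, IsPureOverlapRep G f ∧ repSize f = n}

/-- `S` carries a skeleton subtree of `G`: the induced subgraph on `S` is connected
(hence a subtree of a tree), and within it the neighbor of every leaf has degree 2. -/
def IsSkeletonIn {V : Type*} (G : SimpleGraph V) (S : Set V) : Prop :=
  (G.induce S).Connected ∧
  ∀ x ∈ S, {y | y ∈ S ∧ G.Adj x y}.ncard = 1 →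
    ∀ y ∈ S, G.Adj x y → {z | z ∈ S ∧ G.Adj y z}.ncard = 2


namespace OverlapTree

open SimpleGraph

/-- In a tree, a vertex has at most one neighbor that is not farther from the root. -/
theorem tree_fact {V : Type*} {T : SimpleGraph V} (hT : T.IsTree) {z w a b : V}
    (ha : T.Adj w a) (hb : T.Adj w b) (hda : T.dist z a ≤ T.dist z w)
    (hdb : T.dist z b ≤ T.dist z w) : a = b := by
  have ea : T.dist z w = T.dist z a + 1 := by
    rcases hT.dist_eq_dist_add_one_of_adj z ha with h | h <;> omega
  have eb : T.dist z w = T.dist z b + 1 := by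
    rcases hT.dist_eq_dist_add_one_of_adj z hb with h | h <;> omega
  obtain ⟨p, hp, hpl⟩ := hT.connected.exists_path_of_dist z a
  obtain ⟨r, hr, hrl⟩ := hT.connected.exists_path_of_dist z b
  have h1 : (p.concat ha.symm).IsPath :=
    Walk.isPath_of_length_eq_dist _ (by rw [Walk.length_concat]; omega)
  have h2 : (r.concat hb.symm).IsPath :=
    Walk.isPath_of_length_eq_dist _ (by rw [Walk.length_concat]; omega)
  have h3 := (hT.existsUnique_path z w).unique h1 h2
  have h4 := congrArg Walk.penultimate h3
  simpa using h4

/-- A connected induced subgraph of a tree is convex. -/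
theorem tree_convex {V : Type*} {T : SimpleGraph V} (hT : T.IsTree) {S : Set V}
    (hS : (T.induce S).Connected) {u v : V} (hu : u ∈ S) (hv : v ∈ S) (huv : u ≠ v) :
    ∃ w ∈ S, T.Adj u w ∧ T.dist w v < T.dist u v := by
  obtain ⟨p, hp, -⟩ := hS.exists_path_of_dist ⟨u, hu⟩ ⟨v, hv⟩
  cases p with
  | nil => exact absurd rfl huv
  | @cons _ w _ h p' =>
    refine ⟨w.1, w.2, h, ?_⟩
    have hm : ((Walk.cons h p').map (Embedding.induce S).toHom).IsPath :=
      Walk.IsPath.map (Embedding.induce (G := T) S).injective hp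
    obtain ⟨r, hr, hrl⟩ := hT.connected.exists_path_of_dist u v
    have h3 := (hT.existsUnique_path u v).unique hm hr
    have h4 := congrArg Walk.length h3
    simp only [Walk.map_cons, Walk.length_cons, Walk.length_map] at h4
    have h5 := T.dist_le (p'.map (Embedding.induce S).toHom)
    simp only [Walk.length_map] at h5
    change T.dist w.1 v ≤ _ at h5
    have h6 : T.dist w.1 v < p'.length + 1 := by omega
    exact lt_of_lt_of_eq h6 (h4.trans hrl)

/-- Rooting a tree. -/
theorem tree_rooted {V : Type*} {T : SimpleGraph V} (hT : T.IsTree) (q : V) :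
    ∃ par : V → V, par q = q ∧ (∀ v, v ≠ q → T.dist q (par v) + 1 = T.dist q v) ∧
      (∀ u v, T.Adj u v ↔ (u ≠ q ∧ par u = v) ∨ (v ≠ q ∧ par v = u)) := by
  classical
  have key : ∀ v, v ≠ q → ∃ w, T.Adj v w ∧ T.dist q w + 1 = T.dist q v := by
    intro v hv
    obtain ⟨p, hp, hpl⟩ := hT.connected.exists_path_of_dist v q
    cases p with
    | nil => exact absurd rfl hv
    | @cons _ w _ h p' =>
      refine ⟨w, h, ?_⟩
      have h1 := T.dist_le p'
      simp only [Walk.length_cons] at hpl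
      rw [T.dist_comm (u := v), T.dist_comm (u := w)] at *
      rcases hT.dist_eq_dist_add_one_of_adj q h with h2 | h2 <;> omega
  choose! par h1 h2 using key
  refine ⟨fun v => if v = q then q else par v, by simp, ?_, ?_⟩
  · intro v hv
    simp only [hv, if_false]
    exact h2 v hv
  · intro u v
    have aux : ∀ u v, T.Adj u v → T.dist q u = T.dist q v + 1 → u ≠ q ∧ par u = v := by
      intro u v h hd
      have hu : u ≠ q := by
        rintro rfl
        simp at hd
      refine ⟨hu, tree_fact hT (z := q) (h1 u hu) h ?_ ?_⟩
      · have := h2 u hu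
        omega
      · omega
    constructor
    · intro h
      rcases hT.dist_eq_dist_add_one_of_adj q h with hd | hd
      · left
        obtain ⟨a, b⟩ := aux u v h hd
        simp [a, b]
      · right
        obtain ⟨a, b⟩ := aux v u h.symm hd
        simp [a, b]
    · rintro (⟨a, b⟩ | ⟨a, b⟩)
      · simp only [a, if_false] at b
        exact b ▸ h1 u a
      · simp only [a, if_false] at b
        exact b ▸ (h1 v a).symm

/-- All four quadrants determined by `u` and `v` are met by `X`. -/
def Cross {V : Type*} (X : Finset ℕ) (f : V → ℕ → Bool) (u v : V) : Prop :=
  ∀ a b : Bool, ∃ t ∈ X, f u t = a ∧ f v t = b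

/-- `y` has `z` as its only neighbor inside `S`. -/
def Leaf {V : Type*} (T : SimpleGraph V) (S : Finset V) (y z : V) : Prop :=
  T.Adj y z ∧ ∀ w ∈ S, T.Adj y w → w = z

/-- The configurations on which the induction for the lower bound runs. -/
structure Cfg {V : Type*} (T : SimpleGraph V) (S M : Finset V) (X : Finset ℕ)
    (f : V → ℕ → Bool) (p q : V → ℕ) : Prop where
  conv : ∀ u ∈ S, ∀ v ∈ S, u ≠ v → ∃ w ∈ S, T.Adj u w ∧ T.dist w v < T.dist u v
  cross : ∀ u ∈ S, ∀ v ∈ S, u ≠ v → (T.Adj u v ↔ Cross X f u v)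
  sub : M ⊆ S
  leaf : ∀ y ∈ M, ∃ z ∈ S, Leaf T S y z
  skel : ∀ y ∈ S, ∀ z ∈ S, Leaf T S y z →
    y ∈ M ∨ ∃ v ∈ S, v ≠ y ∧ T.Adj z v ∧ ∀ w ∈ S, T.Adj z w → w = y ∨ w = v
  pX : ∀ y ∈ M, p y ∈ X
  qX : ∀ y ∈ M, q y ∈ X
  pq : ∀ y ∈ M, f y (p y) ≠ f y (q y)
  sep : ∀ y ∈ M, ∀ w ∈ S, w ≠ y → f w (p y) = f w (q y)
  dpp : ∀ y ∈ M, ∀ y' ∈ M, y ≠ y' → p y ≠ p y'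
  dpq : ∀ y ∈ M, ∀ y' ∈ M, y ≠ y' → p y ≠ q y'
  dqq : ∀ y ∈ M, ∀ y' ∈ M, y ≠ y' → q y ≠ q y'

def Const {V : Type*} (X : Finset ℕ) (f : V → ℕ → Bool) (y : V) (b : Bool) (w : V) : Prop :=
  ∀ t ∈ X, ∀ t' ∈ X, f y t = b → f y t' = b → f w t = f w t'

theorem bool_aux {a b c : Bool} (h1 : a ≠ b) (h2 : c ≠ b) : a = c := by
  cases a <;> cases b <;> cases c <;> simp_all

section
set_option linter.unusedSectionVars false
variable {V : Type*} {T : SimpleGraph V} {S M : Finset V} {X : Finset ℕ}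
  {f : V → ℕ → Bool} {p q : V → ℕ}

theorem exists_leaf (hT : T.IsTree)
    (conv : ∀ u ∈ S, ∀ v ∈ S, u ≠ v → ∃ w ∈ S, T.Adj u w ∧ T.dist w v < T.dist u v)
    (h2 : 2 ≤ S.card) : ∃ y ∈ S, ∃ z ∈ S, Leaf T S y z := by
  obtain ⟨a, ha, b, hb, hab⟩ := Finset.one_lt_card.1 h2
  obtain ⟨y, hy, hmax⟩ := S.exists_max_image (fun w => T.dist a w) ⟨a, ha⟩
  have hya : y ≠ a := by
    rintro rfl
    have h1 : T.dist y b ≤ T.dist y y := hmax b hb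
    have h3 := hT.connected.pos_dist_of_ne hab
    rw [T.dist_self] at h1
    omega
  obtain ⟨z, hz, hyz, hd⟩ := conv y hy a ha hya
  refine ⟨y, hy, z, hz, hyz, fun w hw hyw => ?_⟩
  exact tree_fact hT (z := a) hyw hyz (hmax w hw) (hmax z hz)

theorem no_triangle (hT : T.IsTree) {z a b : V} (ha : T.Adj z a) (hb : T.Adj z b) :
    ¬ T.Adj a b := by
  intro hab
  have h1 : T.dist z a = 1 := T.dist_eq_one_iff_adj.2 ha
  have h2 : T.dist z b = 1 := T.dist_eq_one_iff_adj.2 hb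
  have := tree_fact hT (z := z) ha.symm hab (by simp) (by omega)
  exact hb.ne this

variable [DecidableEq V]

theorem Cfg.conv_erase (C : Cfg T S M X f p q) {y z : V} (hy : y ∈ S) (hl : Leaf T S y z) :
    ∀ u ∈ S.erase y, ∀ v ∈ S.erase y, u ≠ v →
      ∃ w ∈ S.erase y, T.Adj u w ∧ T.dist w v < T.dist u v := by
  intro u hu v hv huv
  rw [Finset.mem_erase] at hu hv
  obtain ⟨w, hw, h1, h2⟩ := C.conv u hu.2 v hv.2 huv
  by_cases hwy : w = y
  · subst hwy
    obtain ⟨x, hx, h3, h4⟩ := C.conv w hy v hv.2 (Ne.symm hv.1)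
    have e1 := hl.2 u hu.2 h1.symm
    have e2 := hl.2 x hx h3
    rw [e1] at h2
    rw [e2] at h4
    omega
  · exact ⟨w, Finset.mem_erase.2 ⟨hwy, hw⟩, h1, h2⟩

theorem Cfg.const_some (C : Cfg T S M X f p q) {y z w : V} (hy : y ∈ S) (hl : Leaf T S y z)
    (hw : w ∈ S) (hwy : w ≠ y) (hwz : w ≠ z) : ∃ b, Const X f y b w := by
  have h : ¬ Cross X f y w := fun h => hwz (hl.2 w hw ((C.cross y hy w hw hwy.symm).2 h))
  unfold Cross at h
  push Not at h
  obtain ⟨a, c, h⟩ := h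
  exact ⟨a, fun t ht t' ht' h1 h2 => bool_aux (h t ht h1) (h t' ht' h2)⟩

theorem Cfg.const_prop (C : Cfg T S M X f p q) {y z w w' : V} {b : Bool} (hy : y ∈ S)
    (hl : Leaf T S y z) (hw : w ∈ S) (hw' : w' ∈ S) (hwy' : w' ≠ y) (hwz' : w' ≠ z)
    (hadj : T.Adj w w') (hc : Const X f y b w) : Const X f y b w' := by
  obtain ⟨a, ha⟩ := C.const_some hy hl hw' hwy' hwz'
  by_cases hab : a = b
  · exact hab ▸ ha
  exfalso
  have hcr := (C.cross w hw w' hw' hadj.ne).1 hadj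
  obtain ⟨t1, k1, l1, m1⟩ := hcr true true
  obtain ⟨t2, k2, l2, m2⟩ := hcr true false
  obtain ⟨t3, k3, l3, m3⟩ := hcr false true
  obtain ⟨t4, k4, l4, m4⟩ := hcr false false
  have hside : ∀ t, f y t = a ∨ f y t = b := by
    intro t
    by_cases h : f y t = b
    · exact Or.inr h
    · exact Or.inl (bool_aux h hab)
  have d1 := fun t ht t' ht' => hc t ht t' ht'
  have d2 := fun t ht t' ht' => ha t ht t' ht'
  rcases hside t1 with h1 | h1 <;> rcases hside t2 with h2 | h2 <;>
    rcases hside t3 with h3 | h3 <;> rcases hside t4 with h4 | h4 <;>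
    first
    | (have := d1 t1 k1 t3 k3 h1 h3; simp_all)
    | (have := d1 t1 k1 t4 k4 h1 h4; simp_all)
    | (have := d1 t2 k2 t3 k3 h2 h3; simp_all)
    | (have := d1 t2 k2 t4 k4 h2 h4; simp_all)
    | (have := d2 t1 k1 t2 k2 h1 h2; simp_all)
    | (have := d2 t1 k1 t4 k4 h1 h4; simp_all)
    | (have := d2 t3 k3 t2 k2 h3 h2; simp_all)
    | (have := d2 t3 k3 t4 k4 h3 h4; simp_all)

/-- Choose the pair of a marked leaf according to a side. -/
theorem Cfg.pair (C : Cfg T S M X f p q) {y : V} (hy : y ∈ M) (b : Bool) :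
    ∃ p0 ∈ X, ∃ q0 ∈ X, f y p0 = b ∧ f y q0 ≠ b ∧ (∀ w ∈ S, w ≠ y → f w p0 = f w q0) ∧
      ∀ y' ∈ M, y' ≠ y → p y' ≠ p0 ∧ p y' ≠ q0 ∧ q y' ≠ p0 ∧ q y' ≠ q0 := by
  by_cases h : f y (p y) = b
  · refine ⟨p y, C.pX y hy, q y, C.qX y hy, h, ?_, C.sep y hy, ?_⟩
    · intro h2
      exact C.pq y hy (h.trans h2.symm)
    · intro y' hy' hne
      exact ⟨C.dpp _ hy' _ hy hne, C.dpq _ hy' _ hy hne, (C.dpq _ hy _ hy' hne.symm).symm,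
        C.dqq _ hy' _ hy hne⟩
  · refine ⟨q y, C.qX y hy, p y, C.pX y hy, ?_, h, fun w hw hne => (C.sep y hy w hw hne).symm, ?_⟩
    · exact bool_aux (C.pq y hy).symm (Ne.symm h)
    · intro y' hy' hne
      exact ⟨C.dpq _ hy' _ hy hne, C.dpp _ hy' _ hy hne, C.dqq _ hy' _ hy hne,
        (C.dpq _ hy _ hy' hne.symm).symm⟩

/-- Forget the mark of `y`, saving an element if there was a mark. -/
theorem Cfg.shrink (C : Cfg T S M X f p q) (y : V) (b : Bool) :
    ∃ X' ⊆ X, X'.card + M.card ≤ X.card + (M.erase y).card ∧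
      (∀ t ∈ X, f y t = b → t ∈ X') ∧
      (∀ t ∈ X, ∃ t' ∈ X', ∀ w ∈ S, w ≠ y → f w t = f w t') ∧
      (∀ y' ∈ M, y' ≠ y → p y' ∈ X' ∧ q y' ∈ X') := by
  by_cases hy : y ∈ M
  · obtain ⟨p0, hp0, q0, hq0, h1, h2, h3, h4⟩ := C.pair hy b
    refine ⟨X.erase q0, Finset.erase_subset _ _, ?_, ?_, ?_, ?_⟩
    · rw [Finset.card_erase_of_mem hq0, Finset.card_erase_of_mem hy]
      have := Finset.card_pos.2 ⟨_, hq0⟩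
      have := Finset.card_pos.2 ⟨_, hy⟩
      omega
    · intro t ht hb
      refine Finset.mem_erase.2 ⟨?_, ht⟩
      rintro rfl
      exact h2 hb
    · intro t ht
      by_cases htq : t = q0
      · subst htq
        refine ⟨p0, Finset.mem_erase.2 ⟨?_, hp0⟩, fun w hw hne => (h3 w hw hne).symm⟩
        rintro rfl
        exact h2 h1
      · exact ⟨t, Finset.mem_erase.2 ⟨htq, ht⟩, fun _ _ _ => rfl⟩
    · intro y' hy' hne
      obtain ⟨a1, a2, a3, a4⟩ := h4 y' hy' hne
      exact ⟨Finset.mem_erase.2 ⟨a2, C.pX _ hy'⟩, Finset.mem_erase.2 ⟨a4, C.qX _ hy'⟩⟩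
  · refine ⟨X, subset_rfl, ?_, fun t ht _ => ht, fun t ht => ⟨t, ht, fun _ _ _ => rfl⟩,
      fun y' hy' _ => ⟨C.pX _ hy', C.qX _ hy'⟩⟩
    rw [Finset.erase_eq_of_notMem hy]

theorem Cross.mono {X X' : Finset ℕ} (h : X' ⊆ X) {u v : V} (hc : Cross X' f u v) :
    Cross X f u v := by
  intro a b
  obtain ⟨t, ht, h1⟩ := hc a b
  exact ⟨t, h ht, h1⟩

/-- Removing a leaf whose neighbor has degree two. -/
theorem Cfg.stepA (C : Cfg T S M X f p q) {y z v : V} (hy : y ∈ S) (hz : z ∈ S)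
    (hl : Leaf T S y z) (hv : v ∈ S) (hvy : v ≠ y) (hzv : T.Adj z v)
    (hdeg : ∀ w ∈ S, T.Adj z w → w = y ∨ w = v) (hvl : Leaf T S v z → v ∈ M) :
    ∃ M' X' p' q', Cfg T (S.erase y) M' X' f p' q' ∧ X'.card + M.card + 1 ≤ X.card + M'.card := by
  have hyz : y ≠ z := hl.1.ne
  have hvz : v ≠ z := hzv.ne.symm
  have hzM : z ∉ M := by
    intro h
    obtain ⟨x, -, hx⟩ := C.leaf z h
    exact hvy ((hx.2 v hv hzv).trans (hx.2 y hy hl.1.symm).symm)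
  obtain ⟨b, hb⟩ := C.const_some hy hl hv hvy hvz
  have hall : ∀ n, ∀ w ∈ S, T.dist w z = n → w ≠ y → w ≠ z → Const X f y b w := by
    intro n
    induction n using Nat.strong_induction_on with
    | _ n ih =>
      intro w hw hn hwy hwz
      obtain ⟨w', hw', h1, h2⟩ := C.conv w hw z hz hwz
      by_cases h3 : w' = z
      · subst h3
        rcases hdeg w hw h1.symm with h4 | h4
        · exact absurd h4 hwy
        · exact h4 ▸ hb
      have h4 : w' ≠ y := by
        rintro rfl
        exact hwz (hl.2 w hw h1.symm)
      exact C.const_prop hy hl hw' hw hwy hwz h1.symm (ih _ (by omega) w' hw' rfl h4 h3)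
  have hcr := (C.cross y hy z hz hyz).1 hl.1
  obtain ⟨e, he, he1, he2⟩ := hcr b true
  obtain ⟨e', he', he1', he2'⟩ := hcr b false
  obtain ⟨X', hX', hcard, hY, hrep, hpairs⟩ := C.shrink y b
  have heo : ∀ y' ∈ M, y' ≠ y → ∀ t ∈ X, f y t = b → p y' ≠ t ∧ q y' ≠ t := by
    intro y' hy' hne t ht htb
    have hyz' : y' ≠ z := fun h => hzM (h ▸ hy')
    have hc := hall _ y' (C.sub hy') rfl hne hyz'
    have hs := C.sep y' hy' y hy hne.symm
    constructor
    · rintro rfl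
      exact C.pq y' hy' (hc _ (C.pX _ hy') _ (C.qX _ hy') htb (hs ▸ htb))
    · rintro rfl
      exact C.pq y' hy' (hc _ (C.pX _ hy') _ (C.qX _ hy') (hs ▸ htb) htb)
  refine ⟨insert z (M.erase y), X', Function.update p z e, Function.update q z e', ?_, ?_⟩
  swap
  · rw [Finset.card_insert_of_notMem (by simp [hzM])]
    omega
  have hzS : z ∈ S.erase y := Finset.mem_erase.2 ⟨hyz.symm, hz⟩
  have hMz : ∀ y' ∈ M, y' ≠ z := fun y' h h2 => hzM (h2 ▸ h)
  refine
    { conv := C.conv_erase hy hl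
      cross := ?_
      sub := ?_
      leaf := ?_
      skel := ?_
      pX := ?_
      qX := ?_
      pq := ?_
      sep := ?_
      dpp := ?_
      dpq := ?_
      dqq := ?_ }
  · intro u hu w hw huw
    rw [Finset.mem_erase] at hu hw
    rw [C.cross u hu.2 w hw.2 huw]
    refine ⟨fun h a c => ?_, fun h => h.mono hX'⟩
    obtain ⟨t, ht, h1, h2⟩ := h a c
    obtain ⟨t', ht', h3⟩ := hrep t ht
    exact ⟨t', ht', (h3 u hu.2 hu.1) ▸ h1, (h3 w hw.2 hw.1) ▸ h2⟩
  · intro u hu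
    rcases Finset.mem_insert.1 hu with rfl | hu
    · exact hzS
    · exact Finset.erase_subset_erase _ C.sub hu
  · intro u hu
    rcases Finset.mem_insert.1 hu with rfl | hu
    · refine ⟨v, Finset.mem_erase.2 ⟨hvy, hv⟩, hzv, fun w hw huw => ?_⟩
      rw [Finset.mem_erase] at hw
      exact (hdeg w hw.2 huw).resolve_left hw.1
    · rw [Finset.mem_erase] at hu
      obtain ⟨x, hx, hx2⟩ := C.leaf u hu.2
      refine ⟨x, Finset.mem_erase.2 ⟨?_, hx⟩, hx2.1, fun w hw => hx2.2 w (Finset.mem_of_mem_erase hw)⟩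
      rintro rfl
      exact hMz u hu.2 (hl.2 u (C.sub hu.2) hx2.1.symm)
  · intro u hu x hx hux
    rw [Finset.mem_erase] at hu hx
    by_cases huz : u = z
    · left
      simp [huz]
    have hux' : Leaf T S u x := by
      refine ⟨hux.1, fun w hw huw => ?_⟩
      by_cases hwy : w = y
      · subst hwy
        exact absurd (hl.2 u hu.2 huw.symm) huz
      · exact hux.2 w (Finset.mem_erase.2 ⟨hwy, hw⟩) huw
    rcases C.skel u hu.2 x hx.2 hux' with h | ⟨v', hv', h1, h2, h3⟩
    · left
      simp [h, hu.1]
    · by_cases hxz : x = z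
      · subst hxz
        have huv : u = v := (hdeg u hu.2 hux.1.symm).resolve_left hu.1
        subst huv
        left
        simp [hvl hux', hu.1]
      · right
        have hxy : ¬ T.Adj x y := fun h => hxz (hl.2 x hx.2 h.symm)
        refine ⟨v', Finset.mem_erase.2 ⟨?_, hv'⟩, h1, h2,
          fun w hw => h3 w (Finset.mem_of_mem_erase hw)⟩
        rintro rfl
        exact hxy h2
  · intro u hu
    rcases Finset.mem_insert.1 hu with rfl | hu
    · simpa using hY e he he1
    · rw [Finset.mem_erase] at hu
      simpa [hMz u hu.2] using (hpairs u hu.2 hu.1).1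
  · intro u hu
    rcases Finset.mem_insert.1 hu with rfl | hu
    · simpa using hY e' he' he1'
    · rw [Finset.mem_erase] at hu
      simpa [hMz u hu.2] using (hpairs u hu.2 hu.1).2
  · intro u hu
    rcases Finset.mem_insert.1 hu with rfl | hu
    · simp [he2, he2']
    · rw [Finset.mem_erase] at hu
      simpa [hMz u hu.2] using C.pq u hu.2
  · intro u hu w hw hwu
    rw [Finset.mem_erase] at hw
    rcases Finset.mem_insert.1 hu with rfl | hu
    · simpa using hall _ w hw.2 rfl hw.1 hwu e he e' he' he1 he1'
    · rw [Finset.mem_erase] at hu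
      simpa [hMz u hu.2] using C.sep u hu.2 w hw.2 hwu
  · intro u hu w hw hwu
    rw [Finset.mem_insert] at hu hw
    rcases hu with rfl | hu <;> rcases hw with rfl | hw
    · exact absurd rfl hwu
    · rw [Finset.mem_erase] at hw
      simpa [hwu.symm] using (heo w hw.2 hw.1 e he he1).1.symm
    · rw [Finset.mem_erase] at hu
      simpa [hwu] using (heo u hu.2 hu.1 e he he1).1
    · rw [Finset.mem_erase] at hu hw
      simpa [hMz u hu.2, hMz w hw.2] using C.dpp u hu.2 w hw.2 hwu
  · intro u hu w hw hwu
    rw [Finset.mem_insert] at hu hw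
    rcases hu with rfl | hu <;> rcases hw with rfl | hw
    · exact absurd rfl hwu
    · rw [Finset.mem_erase] at hw
      simpa [hwu.symm] using (heo w hw.2 hw.1 e he he1).2.symm
    · rw [Finset.mem_erase] at hu
      simpa [hwu] using (heo u hu.2 hu.1 e' he' he1').1
    · rw [Finset.mem_erase] at hu hw
      simpa [hMz u hu.2, hMz w hw.2] using C.dpq u hu.2 w hw.2 hwu
  · intro u hu w hw hwu
    rw [Finset.mem_insert] at hu hw
    rcases hu with rfl | hu <;> rcases hw with rfl | hw
    · exact absurd rfl hwu
    · rw [Finset.mem_erase] at hw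
      simpa [hwu.symm] using (heo w hw.2 hw.1 e' he' he1').2.symm
    · rw [Finset.mem_erase] at hu
      simpa [hwu] using (heo u hu.2 hu.1 e' he' he1').2
    · rw [Finset.mem_erase] at hu hw
      simpa [hMz u hu.2, hMz w hw.2] using C.dqq u hu.2 w hw.2 hwu

/-- Removing a marked leaf and two elements. -/
theorem Cfg.stepB_aux (C : Cfg T S M X f p q) {y z : V} {b : Bool} (hy : y ∈ M)
    (hl : Leaf T S y z) (hzM : z ∉ M)
    (hall : ∀ w ∈ S, w ≠ y → w ≠ z → Const X f y b w)
    (hmark : ∀ u ∈ S.erase y, ∀ x ∈ S.erase y, Leaf T (S.erase y) u x → u ∈ M)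
    {p0 q0 g g' : ℕ} (hp0 : p0 ∈ X) (hp0b : f y p0 = b) (hq0b : f y q0 ≠ b)
    (hsep : ∀ w ∈ S, w ≠ y → f w p0 = f w q0)
    (hdis : ∀ y' ∈ M, y' ≠ y → p y' ≠ p0 ∧ p y' ≠ q0 ∧ q y' ≠ p0 ∧ q y' ≠ q0)
    (hg : g ∈ X) (hgb : f y g = b) (hg' : g' ∈ X) (hgb' : f y g' = b) (hgg : g ≠ g')
    (hrem : ∀ w ∈ S, w ≠ y → T.Adj z w →
      ∃ t ∈ X.erase q0, t ≠ g ∧ f z t = f z g ∧ f w t = f w g) :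
    Cfg T (S.erase y) (M.erase y) ((X.erase q0).erase g) f p q := by
  have hyS := C.sub hy
  have hpX : ∀ t ∈ X, ∃ t' ∈ X.erase q0, ∀ w ∈ S, w ≠ y → f w t = f w t' := by
    intro t ht
    by_cases htq : t = q0
    · subst htq
      refine ⟨p0, Finset.mem_erase.2 ⟨?_, hp0⟩, fun w hw hne => (hsep w hw hne).symm⟩
      rintro rfl
      exact hq0b hp0b
    · exact ⟨t, Finset.mem_erase.2 ⟨htq, ht⟩, fun _ _ _ => rfl⟩
  have heo : ∀ y' ∈ M, y' ≠ y → p y' ≠ g ∧ q y' ≠ g := by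
    intro y' hy' hne
    have hyz' : y' ≠ z := fun h => hzM (h ▸ hy')
    have hc := hall y' (C.sub hy') hne hyz'
    have hs := C.sep y' hy' y hyS hne.symm
    constructor
    · rintro rfl
      exact C.pq y' hy' (hc _ (C.pX _ hy') _ (C.qX _ hy') hgb (hs ▸ hgb))
    · rintro rfl
      exact C.pq y' hy' (hc _ (C.pX _ hy') _ (C.qX _ hy') (hs ▸ hgb) hgb)
  have hg'2 : g' ∈ (X.erase q0).erase g := by
    refine Finset.mem_erase.2 ⟨hgg.symm, Finset.mem_erase.2 ⟨?_, hg'⟩⟩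
    rintro rfl
    exact hq0b hgb'
  refine
    { conv := C.conv_erase hyS hl
      cross := ?_
      sub := Finset.erase_subset_erase _ C.sub
      leaf := ?_
      skel := ?_
      pX := ?_
      qX := ?_
      pq := fun u hu => C.pq u (Finset.mem_of_mem_erase hu)
      sep := fun u hu w hw => C.sep u (Finset.mem_of_mem_erase hu) w (Finset.mem_of_mem_erase hw)
      dpp := fun u hu w hw => C.dpp u (Finset.mem_of_mem_erase hu) w (Finset.mem_of_mem_erase hw)
      dpq := fun u hu w hw => C.dpq u (Finset.mem_of_mem_erase hu) w (Finset.mem_of_mem_erase hw)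
      dqq := fun u hu w hw => C.dqq u (Finset.mem_of_mem_erase hu) w (Finset.mem_of_mem_erase hw) }
  · intro u hu w hw huw
    rw [Finset.mem_erase] at hu hw
    refine ⟨fun hadj a c => ?_, fun h => (C.cross u hu.2 w hw.2 huw).2
      (h.mono ((Finset.erase_subset _ _).trans (Finset.erase_subset _ _)))⟩
    obtain ⟨t, ht, h1, h2⟩ := (C.cross u hu.2 w hw.2 huw).1 hadj a c
    obtain ⟨t', ht', h3⟩ := hpX t ht
    have h1' : f u t' = a := (h3 u hu.2 hu.1) ▸ h1
    have h2' : f w t' = c := (h3 w hw.2 hw.1) ▸ h2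
    by_cases htg : t' = g
    · subst htg
      by_cases huz : u = z
      · subst huz
        obtain ⟨s, hs, k1, k2, k3⟩ := hrem w hw.2 hw.1 hadj
        exact ⟨s, Finset.mem_erase.2 ⟨k1, hs⟩, k2.trans h1', k3.trans h2'⟩
      by_cases hwz : w = z
      · subst hwz
        obtain ⟨s, hs, k1, k2, k3⟩ := hrem u hu.2 hu.1 hadj.symm
        exact ⟨s, Finset.mem_erase.2 ⟨k1, hs⟩, k3.trans h1', k2.trans h2'⟩
      refine ⟨g', hg'2, ?_, ?_⟩
      · rw [← h1']
        exact hall u hu.2 hu.1 huz _ hg' _ hg hgb' hgb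
      · rw [← h2']
        exact hall w hw.2 hw.1 hwz _ hg' _ hg hgb' hgb
    · exact ⟨t', Finset.mem_erase.2 ⟨htg, ht'⟩, h1', h2'⟩
  · intro u hu
    rw [Finset.mem_erase] at hu
    obtain ⟨x, hx, hx2⟩ := C.leaf u hu.2
    refine ⟨x, Finset.mem_erase.2 ⟨?_, hx⟩, hx2.1, fun w hw => hx2.2 w (Finset.mem_of_mem_erase hw)⟩
    rintro rfl
    exact hzM ((hl.2 u (C.sub hu.2) hx2.1.symm) ▸ hu.2)
  · intro u hu x hx hux
    exact Or.inl (Finset.mem_erase.2 ⟨(Finset.mem_erase.1 hu).1, hmark u hu x hx hux⟩)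
  · intro u hu
    rw [Finset.mem_erase] at hu
    exact Finset.mem_erase.2 ⟨(heo u hu.2 hu.1).1, Finset.mem_erase.2
      ⟨(hdis u hu.2 hu.1).2.1, C.pX u hu.2⟩⟩
  · intro u hu
    rw [Finset.mem_erase] at hu
    exact Finset.mem_erase.2 ⟨(heo u hu.2 hu.1).2, Finset.mem_erase.2
      ⟨(hdis u hu.2 hu.1).2.2.2, C.qX u hu.2⟩⟩

/-- A neighbor of the vertex z cannot have a side with just two elements. -/
theorem Cfg.stepB_key (C : Cfg T S M X f p q) {y z : V} {b : Bool} (hy : y ∈ M)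
    (hl : Leaf T S y z) (hz : z ∈ S)
    (hall : ∀ w ∈ S, w ≠ y → w ≠ z → Const X f y b w)
    (hmark : ∀ u ∈ S, ∀ x ∈ S, Leaf T S u x → u ∈ M)
    {e q0 e' : ℕ} (hq0b : f y q0 ≠ b)
    (hsep : ∀ w ∈ S, w ≠ y → f w e = f w q0)
    (hdis : ∀ y' ∈ M, y' ≠ y → p y' ≠ e ∧ p y' ≠ q0 ∧ q y' ≠ e ∧ q y' ≠ q0)
    (he : e ∈ X) (heb : f y e = b) (he' : e' ∈ X) (heb' : f y e' = b)
    {w : V} (hw : w ∈ S) (hwy : w ≠ y) (hzw : T.Adj z w)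
    (hside : ∀ t ∈ X.erase q0, f w t = f w e → t = e ∨ t = e') : False := by
  have hwz : w ≠ z := hzw.ne.symm
  have hyS := C.sub hy
  have hYw := hall w hw hwy hwz
  have hY : ∀ t ∈ X, f y t = b → t = e ∨ t = e' := by
    intro t ht htb
    refine hside t (Finset.mem_erase.2 ⟨?_, ht⟩) (hYw t ht e he htb heb)
    rintro rfl
    exact hq0b htb
  have hleaf : Leaf T S w z := by
    refine ⟨hzw.symm, fun w2 hw2 h2 => ?_⟩
    by_contra hne
    have hw2y : w2 ≠ y := by
      rintro rfl
      exact hwz (hl.2 w hw h2.symm)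
    have hc := hall w2 hw2 hw2y hne
    obtain ⟨t, ht, k1, k2⟩ := (C.cross w hw w2 hw2 h2.ne).1 h2 (f w e) (!(f w2 e))
    have : f w2 t = f w2 e := by
      by_cases htq : t = q0
      · rw [htq]
        exact (hsep w2 hw2 hw2y).symm
      · rcases hside t (Finset.mem_erase.2 ⟨htq, ht⟩) k1 with h | h
        · rw [h]
        · rw [h]
          exact hc _ he' _ he heb' heb
    rw [this] at k2
    cases h : f w2 e <;> simp [h] at k2
  have hwM := hmark w hw z hz hleaf
  have hd := hdis w hwM hwy
  have hfin : ∀ p1 ∈ X, ∀ q1 ∈ X, p1 ≠ e → p1 ≠ q0 → f w p1 = f w e → f w q1 ≠ f w p1 →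
      f y p1 = f y q1 → False := by
    intro p1 hp1 q1 hq1 h1 h2 h3 h4 h5
    have h6 := (hside p1 (Finset.mem_erase.2 ⟨h2, hp1⟩) h3).resolve_left h1
    rw [h6, heb'] at h5
    rcases hY q1 hq1 h5.symm with h | h
    · rw [h, h3] at h4
      exact h4 rfl
    · rw [h, h6] at h4
      exact h4 rfl
  have hpq := C.pq w hwM
  have hs := C.sep w hwM y hyS hwy.symm
  by_cases h : f w (p w) = f w e
  · exact hfin _ (C.pX w hwM) _ (C.qX w hwM) hd.1 hd.2.1 h hpq.symm hs
  · have h' : f w (q w) = f w e := bool_aux hpq.symm (Ne.symm h)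
    exact hfin _ (C.qX w hwM) _ (C.pX w hwM) hd.2.2.1 hd.2.2.2 h' hpq hs.symm

theorem Cfg.stepB (C : Cfg T S M X f p q) (hT : T.IsTree) (h3 : 3 ≤ S.card)
    (hmark : ∀ u ∈ S, ∀ x ∈ S, Leaf T S u x → u ∈ M)
    (hdeg : ∀ y ∈ S, ∀ z ∈ S, Leaf T S y z →
      ¬ ∃ v ∈ S, v ≠ y ∧ T.Adj z v ∧ ∀ w ∈ S, T.Adj z w → w = y ∨ w = v) :
    ∃ y ∈ S, ∃ M' X', Cfg T (S.erase y) M' X' f p q ∧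
      X'.card + M.card + 1 ≤ X.card + M'.card := by
  obtain ⟨y1, hy1, z1, hz1, hl1⟩ := exists_leaf hT C.conv (by omega)
  have hM1 := hmark y1 hy1 z1 hz1 hl1
  obtain ⟨⟨y, b⟩, hyb, hmin⟩ := (M ×ˢ (Finset.univ : Finset Bool)).exists_min_image
    (fun x => (X.filter (fun t => f x.1 t = x.2)).card) ⟨(y1, true), by simp [hM1]⟩
  have hy : y ∈ M := (Finset.mem_product.1 hyb).1
  have hyS := C.sub hy
  obtain ⟨z, hz, hl⟩ := C.leaf y hy
  have hyz : y ≠ z := hl.1.ne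
  -- every other vertex is constant on the chosen side
  have hall : ∀ w ∈ S, w ≠ y → w ≠ z → Const X f y b w := by
    by_contra hcon
    push Not at hcon
    obtain ⟨w0, hw0, hw0y, hw0z, hw0c⟩ := hcon
    classical
    obtain ⟨w, hw, hmax⟩ := (S.filter (fun w => w ≠ y ∧ w ≠ z ∧ ¬ Const X f y b w)).exists_max_image
      (fun w => T.dist z w) ⟨w0, by simp [hw0, hw0y, hw0z, hw0c]⟩
    obtain ⟨hwS, hwy, hwz, hwc⟩ := Finset.mem_filter.1 hw
    obtain ⟨w1, hw1, had1, hd1⟩ := C.conv w hwS z hz hwz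
    by_cases hleaf : Leaf T S w w1
    · have hwM := hmark w hwS w1 hw1 hleaf
      obtain ⟨a, ha⟩ := C.const_some hyS hl hwS hwy hwz
      by_cases hab : a = b
      · exact hwc (hab ▸ ha)
      -- pick the value of `w` on side `a`
      obtain ⟨t0, ht0, ht0a, -⟩ := (C.cross y hyS z hz hyz).1 hl.1 a true
      have hsub : X.filter (fun t => f w t = !(f w t0)) ⊆ X.filter (fun t => f y t = b) := by
        intro t ht
        rw [Finset.mem_filter] at ht ⊢
        refine ⟨ht.1, ?_⟩
        by_contra hne
        have h4 : f y t = a := bool_aux hne hab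
        have h5 := ha t ht.1 t0 ht0 h4 ht0a
        have h6 := ht.2
        rw [h5] at h6
        cases h7 : f w t0 <;> simp [h7] at h6
      have heq := Finset.eq_of_subset_of_card_le hsub
        (hmin (w, !(f w t0)) (by simp [hwM]))
      apply hwc
      intro t ht t' ht' h4 h5
      have k1 : t ∈ X.filter (fun t => f w t = !(f w t0)) := by
        rw [heq]; simp [ht, h4]
      have k2 : t' ∈ X.filter (fun t => f w t = !(f w t0)) := by
        rw [heq]; simp [ht', h5]
      exact (Finset.mem_filter.1 k1).2.trans (Finset.mem_filter.1 k2).2.symm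
    · have : ∃ w2 ∈ S, T.Adj w w2 ∧ w2 ≠ w1 := by
        by_contra hno
        push Not at hno
        exact hleaf ⟨had1, hno⟩
      obtain ⟨w2, hw2, had2, hne⟩ := this
      have hfar : T.dist z w < T.dist z w2 := by
        by_contra hle
        rw [T.dist_comm (u := w1), T.dist_comm (u := w)] at hd1
        exact hne (tree_fact hT (z := z) had2 had1 (by omega) hd1.le)
      have hw2z : w2 ≠ z := by
        rintro rfl
        simp at hfar
      have hw2y : w2 ≠ y := by
        rintro rfl
        exact hwz (hl.2 w hwS had2.symm)
      have hc2 : Const X f y b w2 := by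
        by_contra hc2
        have := hmax w2 (by simp [hw2, hw2y, hw2z, hc2])
        omega
      exact hwc (C.const_prop hyS hl hw2 hwS hwy hwz had2.symm hc2)
  -- `z` has two further neighbors
  have hnb1 : ∃ v ∈ S, v ≠ y ∧ T.Adj z v := by
    have hcard : 0 < ((S.erase y).erase z).card := by
      rw [Finset.card_erase_of_mem (Finset.mem_erase.2 ⟨hyz.symm, hz⟩),
        Finset.card_erase_of_mem hyS]
      omega
    obtain ⟨x, hx⟩ := Finset.card_pos.1 hcard
    rw [Finset.mem_erase, Finset.mem_erase] at hx
    obtain ⟨v, hv, h4, -⟩ := C.conv_erase hyS hl z (Finset.mem_erase.2 ⟨hyz.symm, hz⟩) x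
      (Finset.mem_erase.2 hx.2) (Ne.symm hx.1)
    rw [Finset.mem_erase] at hv
    exact ⟨v, hv.2, hv.1, h4⟩
  obtain ⟨v, hv, hvy, hzv⟩ := hnb1
  have hnb2 : ∃ v2 ∈ S, v2 ≠ y ∧ v2 ≠ v ∧ T.Adj z v2 := by
    by_contra hno
    push Not at hno
    refine hdeg y hyS z hz hl ⟨v, hv, hvy, hzv, fun w hw hzw => ?_⟩
    by_contra h
    push Not at h
    exact hno w hw h.1 h.2 hzw
  obtain ⟨v2, hv2, hv2y, hv2v, hzv2⟩ := hnb2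
  have hzM : z ∉ M := by
    intro h
    obtain ⟨x, -, hx⟩ := C.leaf z h
    exact hvy ((hx.2 v hv hzv).trans (hx.2 y hyS hl.1.symm).symm)
  have hmark' : ∀ u ∈ S.erase y, ∀ x ∈ S.erase y, Leaf T (S.erase y) u x → u ∈ M := by
    intro u hu x hx hux
    rw [Finset.mem_erase] at hu hx
    refine hmark u hu.2 x hx.2 ⟨hux.1, fun w hw huw => ?_⟩
    by_cases hwy : w = y
    · subst hwy
      have huz := hl.2 u hu.2 huw.symm
      subst huz
      have a1 := hux.2 v (Finset.mem_erase.2 ⟨hvy, hv⟩) hzv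
      have a2 := hux.2 v2 (Finset.mem_erase.2 ⟨hv2y, hv2⟩) hzv2
      exact absurd (a2.trans a1.symm) hv2v
    · exact hux.2 w (Finset.mem_erase.2 ⟨hwy, hw⟩) huw
  obtain ⟨e, he, q0, hq0, heb, hq0b, hsep, hdis⟩ := C.pair hy b
  obtain ⟨e', he', heb', hze'⟩ := (C.cross y hyS z hz hyz).1 hl.1 b (!(f z e))
  have hee : f z e' ≠ f z e := by
    rw [hze']
    cases f z e <;> simp
  have hne : e ≠ e' := by
    rintro rfl
    exact hee rfl
  have heq : e ≠ q0 := by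
    rintro rfl
    exact hq0b heb
  have heq' : e' ≠ q0 := by
    rintro rfl
    exact hq0b heb'
  have hcount : ∀ g ∈ X, g ≠ q0 →
      ((X.erase q0).erase g).card + M.card + 1 ≤ X.card + (M.erase y).card := by
    intro g hg hgq
    have h4 := Finset.card_erase_of_mem (Finset.mem_erase.2 ⟨hgq, hg⟩)
    have h5 := Finset.card_erase_of_mem hq0
    have h6 := Finset.card_erase_of_mem hy
    have h7 := Finset.card_pos.2 ⟨_, Finset.mem_erase.2 ⟨hgq, hg⟩⟩
    have h8 := Finset.card_pos.2 ⟨_, hy⟩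
    omega
  refine ⟨y, hyS, M.erase y, ?_⟩
  by_cases hrem : ∀ w ∈ S, w ≠ y → T.Adj z w →
      ∃ t ∈ X.erase q0, t ≠ e ∧ f z t = f z e ∧ f w t = f w e
  · exact ⟨_, C.stepB_aux hy hl hzM hall hmark' he heb hq0b hsep hdis he heb he' heb' hne hrem,
      hcount e he heq⟩
  by_cases hrem' : ∀ w ∈ S, w ≠ y → T.Adj z w →
      ∃ t ∈ X.erase q0, t ≠ e' ∧ f z t = f z e' ∧ f w t = f w e'
  · exact ⟨_, C.stepB_aux hy hl hzM hall hmark' he heb hq0b hsep hdis he' heb' he heb hne.symm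
      hrem', hcount e' he' heq'⟩
  exfalso
  push Not at hrem hrem'
  obtain ⟨w, hw, hwy, hzw, hw1⟩ := hrem
  obtain ⟨w', hw', hwy', hzw', hw1'⟩ := hrem'
  have hwz := hzw.ne.symm
  have hwz' := hzw'.ne.symm
  have A : ∀ t ∈ X.erase q0, f z t = f z e → f w t = f w e → t = e := by
    intro t ht h1 h2
    by_contra h
    exact hw1 t ht h h1 h2
  have A' : ∀ t ∈ X.erase q0, f z t = f z e' → f w' t = f w' e' → t = e' := by
    intro t ht h1 h2
    by_contra h
    exact hw1' t ht h h1 h2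
  have E : f w e = f w e' := hall w hw hwy hwz _ he _ he' heb heb'
  have E' : f w' e = f w' e' := hall w' hw' hwy' hwz' _ he _ he' heb heb'
  have hzz : ∀ t, f z t = f z e ∨ f z t = f z e' := by
    intro t
    by_cases h : f z t = f z e'
    · exact Or.inr h
    · exact Or.inl (bool_aux h hee.symm)
  have K1 : ¬ ∀ t ∈ X.erase q0, f w t = f w e → f w' t = f w' e := by
    intro hsub
    refine C.stepB_key hy hl hz hall hmark hq0b hsep hdis he heb he' heb' hw hwy hzw ?_
    intro t ht h
    rcases hzz t with h1 | h1
    · exact Or.inl (A t ht h1 h)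
    · exact Or.inr (A' t ht h1 ((hsub t ht h).trans E'))
  have K2 : ¬ ∀ t ∈ X.erase q0, f w' t = f w' e → f w t = f w e := by
    intro hsub
    refine C.stepB_key hy hl hz hall hmark hq0b hsep hdis he heb he' heb' hw' hwy' hzw' ?_
    intro t ht h
    rcases hzz t with h1 | h1
    · exact Or.inl (A t ht h1 (hsub t ht h))
    · exact Or.inr (A' t ht h1 (h.trans E'))
  by_cases hww : w = w'
  · subst hww
    exact K1 fun t _ h => h
  have hnc : ¬ Cross X f w w' := fun h =>
    no_triangle hT hzw hzw' ((C.cross w hw w' hw' hww).2 h)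
  apply hnc
  push Not at K1 K2
  obtain ⟨t1, ht1, h11, h12⟩ := K1
  obtain ⟨t2, ht2, h21, h22⟩ := K2
  obtain ⟨t3, ht3, h31, h32⟩ := (C.cross z hz w' hw' hzw'.ne).1 hzw' (f z e) (!(f w' e))
  have h32' : f w' t3 ≠ f w' e := by
    rw [h32]
    cases f w' e <;> simp
  have h3q : t3 ≠ q0 := by
    rintro rfl
    exact h32' (hsep w' hw' hwy').symm
  have h33 : f w t3 ≠ f w e := by
    intro h
    have := A t3 (Finset.mem_erase.2 ⟨h3q, ht3⟩) h31 h
    rw [this] at h32'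
    exact h32' rfl
  intro a c
  by_cases ha : f w e = a <;> by_cases hc : f w' e = c
  · exact ⟨e, he, ha, hc⟩
  · exact ⟨t1, Finset.mem_of_mem_erase ht1, h11.trans ha, bool_aux h12 (Ne.symm hc)⟩
  · exact ⟨t2, Finset.mem_of_mem_erase ht2, bool_aux h22 (Ne.symm ha), h21.trans hc⟩
  · exact ⟨t3, ht3, bool_aux h33 (Ne.symm ha), bool_aux h32' (Ne.symm hc)⟩

theorem Cfg.bound (hT : T.IsTree) : ∀ (n : ℕ) (S M : Finset V) (X : Finset ℕ) (p q : V → ℕ),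
    S.card = n + 2 → Cfg T S M X f p q → S.card + 1 + M.card ≤ X.card := by
  intro n
  induction n with
  | zero =>
    intro S M X p q hS C
    obtain ⟨y, hy, z, hz, hl⟩ := exists_leaf hT C.conv (by omega)
    have hyz := hl.1.ne
    have hSe : S = {y, z} := by
      symm
      apply Finset.eq_of_subset_of_card_le
      · intro x hx
        simp only [Finset.mem_insert, Finset.mem_singleton] at hx
        rcases hx with rfl | rfl <;> assumption
      · rw [Finset.card_pair hyz]
        omega
    have hor : ∀ w ∈ S, w = y ∨ w = z := by
      intro w hw
      rw [hSe] at hw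
      simpa using hw
    have hlz : Leaf T S z y := by
      refine ⟨hl.1.symm, fun w hw h => ?_⟩
      rcases hor w hw with h1 | h1
      · exact h1
      · exact absurd h1.symm h.ne
    have hyM : y ∈ M := by
      rcases C.skel y hy z hz hl with h | ⟨v, hv, h1, h2, -⟩
      · exact h
      · exact absurd (hlz.2 v hv h2) h1
    have hzM : z ∈ M := by
      rcases C.skel z hz y hy hlz with h | ⟨v, hv, h1, h2, -⟩
      · exact h
      · exact absurd (hl.2 v hv h2) h1
    have hMS : M.card ≤ S.card := Finset.card_le_card C.sub
    obtain ⟨t, ht, h1, h2⟩ := (C.cross y hy z hz hyz).1 hl.1 (!(f y (p z))) (!(f z (p y)))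
    have s1 := C.sep y hyM z hz hyz.symm
    have s2 := C.sep z hzM y hy hyz
    have d1 : t ≠ p y := by
      rintro rfl
      cases h : f z (p y) <;> simp [h] at h2
    have d2 : t ≠ q y := by
      rintro rfl
      rw [s1] at h2
      cases h : f z (q y) <;> simp [h] at h2
    have d3 : t ≠ p z := by
      rintro rfl
      cases h : f y (p z) <;> simp [h] at h1
    have d4 : t ≠ q z := by
      rintro rfl
      rw [s2] at h1
      cases h : f y (q z) <;> simp [h] at h1
    have d5 : p y ≠ q y := fun h => C.pq y hyM (by rw [← h])
    have d6 : p z ≠ q z := fun h => C.pq z hzM (by rw [← h])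
    have d7 := C.dpp y hyM z hzM hyz
    have d8 := C.dpq y hyM z hzM hyz
    have d9 := C.dpq z hzM y hyM hyz.symm
    have d10 := C.dqq y hyM z hzM hyz
    have hsub : ({t, p y, q y, p z, q z} : Finset ℕ) ⊆ X := by
      intro x hx
      simp only [Finset.mem_insert, Finset.mem_singleton] at hx
      rcases hx with rfl | rfl | rfl | rfl | rfl
      · exact ht
      · exact C.pX y hyM
      · exact C.qX y hyM
      · exact C.pX z hzM
      · exact C.qX z hzM
    have hc := Finset.card_le_card hsub
    have hc5 : ({t, p y, q y, p z, q z} : Finset ℕ).card = 5 := by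
      rw [Finset.card_insert_of_notMem, Finset.card_insert_of_notMem,
        Finset.card_insert_of_notMem, Finset.card_pair d6]
      · simp [d9.symm, d10]
      · simp [d5, d7, d8]
      · simp [d1, d2, d3, d4]
    omega
  | succ n ih =>
    intro S M X p q hS C
    have finish : ∀ y ∈ S, ∀ M' X' p' q', Cfg T (S.erase y) M' X' f p' q' →
        X'.card + M.card + 1 ≤ X.card + M'.card → S.card + 1 + M.card ≤ X.card := by
      intro y hy M' X' p' q' C' hc
      have h1 := Finset.card_erase_of_mem hy
      have := ih _ _ _ _ _ (by omega) C'
      omega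
    by_cases hmark : ∀ u ∈ S, ∀ x ∈ S, Leaf T S u x → u ∈ M
    · by_cases hdeg : ∀ y ∈ S, ∀ z ∈ S, Leaf T S y z →
        ¬ ∃ v ∈ S, v ≠ y ∧ T.Adj z v ∧ ∀ w ∈ S, T.Adj z w → w = y ∨ w = v
      · obtain ⟨y, hy, M', X', C', hc⟩ := C.stepB hT (by omega) hmark hdeg
        exact finish y hy M' X' p q C' hc
      · push Not at hdeg
        obtain ⟨y, hy, z, hz, hl, v, hv, hvy, hzv, hd⟩ := hdeg
        obtain ⟨M', X', p', q', C', hc⟩ := C.stepA hy hz hl hv hvy hzv hd (hmark v hv z hz)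
        exact finish y hy M' X' p' q' C' hc
    · push Not at hmark
      obtain ⟨y, hy, z, hz, hl, hyM⟩ := hmark
      obtain ⟨v, hv, hvy, hzv, hd⟩ := (C.skel y hy z hz hl).resolve_left hyM
      by_cases hvl : Leaf T S v z → v ∈ M
      · obtain ⟨M', X', p', q', C', hc⟩ := C.stepA hy hz hl hv hvy hzv hd hvl
        exact finish y hy M' X' p' q' C' hc
      push Not at hvl
      obtain ⟨hvl, hvM⟩ := hvl
      have hS3 : ∀ w ∈ S, w = y ∨ w = z ∨ w = v := by
        by_contra hcon
        push Not at hcon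
        obtain ⟨w0, hw0, hh⟩ := hcon
        obtain ⟨w, hw, hmin⟩ := (S.filter (fun w => w ≠ y ∧ w ≠ z ∧ w ≠ v)).exists_min_image
          (fun w => T.dist w z) ⟨w0, by simp [hw0, hh]⟩
        obtain ⟨hwS, h1, h2, h3⟩ := Finset.mem_filter.1 hw
        obtain ⟨w', hw', k1, k2⟩ := C.conv w hwS z hz h2
        by_cases m1 : w' = y
        · subst m1
          exact h2 (hl.2 w hwS k1.symm)
        by_cases m2 : w' = z
        · subst m2
          rcases hd w hwS k1.symm with h | h
          · exact h1 h
          · exact h3 h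
        by_cases m3 : w' = v
        · subst m3
          exact h2 (hvl.2 w hwS k1.symm)
        have := hmin w' (by simp [hw', m1, m2, m3])
        omega
      have hM0 : M = ∅ := by
        rw [Finset.eq_empty_iff_forall_notMem]
        intro w hw
        rcases hS3 w (C.sub hw) with rfl | rfl | rfl
        · exact hyM hw
        · obtain ⟨x, -, hx⟩ := C.leaf w hw
          exact hvy ((hx.2 v hv hzv).trans (hx.2 y hy hl.1.symm).symm)
        · exact hvM hw
      have hSc : S.card ≤ 3 := by
        have : S ⊆ {y, z, v} := by
          intro w hw
          simpa using hS3 w hw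
        exact (Finset.card_le_card this).trans Finset.card_le_three
      have h4 : 4 ≤ X.card := by
        have hcr := (C.cross y hy z hz hl.1.ne).1 hl.1
        have himg : (Finset.univ : Finset (Bool × Bool)) ⊆ X.image (fun t => (f y t, f z t)) := by
          rintro ⟨a, c⟩ -
          obtain ⟨t, ht, h1, h2⟩ := hcr a c
          exact Finset.mem_image.2 ⟨t, ht, by rw [h1, h2]⟩
        have := (Finset.card_le_card himg).trans Finset.card_image_le
        simpa using this
      rw [hM0]
      simp
      omega

end

theorem lower_bound {V : Type*} [Fintype V] {T : SimpleGraph V} (hT : T.IsTree)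
    (hn : 3 ≤ Fintype.card V) {f : V → Finset ℕ} (hf : IsOverlapRep T f) {S' : Set V}
    (hS : IsSkeletonIn T S') : S'.ncard ≤ repSize f := by
  classical
  set U : Finset ℕ := Finset.univ.biUnion f with hU
  have hsize : repSize f = U.card := by
    unfold repSize
    rw [← Set.ncard_coe_finset]
    congr 1
    ext t
    simp [hU]
  have hmem : ∀ v, f v ⊆ U := fun v => Finset.subset_biUnion_of_mem f (Finset.mem_univ v)
  rw [hsize]
  obtain ⟨hconn, hsk⟩ := hS
  set S : Finset V := S'.toFinset with hSdef
  have hmS : ∀ v, v ∈ S ↔ v ∈ S' := fun v => by simp [hSdef]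
  have hcard : S'.ncard = S.card := by
    rw [Set.ncard_eq_toFinset_card']
  rw [hcard]
  by_cases h2 : S.card < 2
  · have : 0 < U.card := by
      obtain ⟨a, b, hab⟩ := Fintype.exists_pair_of_one_lt_card (α := V) (by omega)
      obtain ⟨w, -, hw, -⟩ := tree_convex hT (S := Set.univ) (u := a) (v := b)
        ((SimpleGraph.induceUnivIso T).connected_iff.2 hT.connected) trivial trivial hab
      obtain ⟨⟨t, ht⟩, -⟩ := (hf a w hw.ne).1 hw
      exact Finset.card_pos.2 ⟨t, hmem a (Finset.mem_inter.1 ht).1⟩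
    omega
  obtain ⟨x, hx⟩ := Infinite.exists_notMem_finset U
  obtain ⟨n, hn2⟩ : ∃ n, S.card = n + 2 := ⟨S.card - 2, by omega⟩
  have C : Cfg T S ∅ (insert x U) (fun v t => decide (t ∈ f v)) (fun _ => 0) (fun _ => 0) := by
    constructor <;> try simp
    · intro u hu v hv huv
      obtain ⟨w, hw, h⟩ := tree_convex hT hconn ((hmS u).1 hu) ((hmS v).1 hv) huv
      exact ⟨w, (hmS w).2 hw, h⟩
    · intro u hu v hv huv
      rw [hf u v huv]
      constructor
      · rintro ⟨⟨t, ht⟩, h1, h2⟩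
        obtain ⟨t1, ht1, ht1'⟩ := Finset.not_subset.1 h1
        obtain ⟨t2, ht2, ht2'⟩ := Finset.not_subset.1 h2
        rw [Finset.mem_inter] at ht
        intro a b
        cases a <;> cases b
        · exact ⟨x, by simp, by simpa using fun h => hx (hmem u h),
            by simpa using fun h => hx (hmem v h)⟩
        · exact ⟨t2, by simp [hmem v ht2], by simpa using ht2', by simpa using ht2⟩
        · exact ⟨t1, by simp [hmem u ht1], by simpa using ht1, by simpa using ht1'⟩
        · exact ⟨t, by simp [hmem u ht.1], by simpa using ht.1, by simpa using ht.2⟩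
      · intro h
        obtain ⟨t, -, h1, h2⟩ := h true true
        obtain ⟨t', -, h1', h2'⟩ := h true false
        obtain ⟨t2, -, h3, h4⟩ := h false true
        simp only [decide_eq_true_eq, decide_eq_false_iff_not] at h1 h2 h1' h2' h3 h4
        exact ⟨⟨t, Finset.mem_inter.2 ⟨h1, h2⟩⟩, fun h => h2' (h h1'), fun h => h3 (h h4)⟩
    · intro y hy z hz ⟨hyz, hl⟩
      have h1 : {w | w ∈ S' ∧ T.Adj y w} = {z} := by
        ext w
        constructor
        · rintro ⟨hw, hyw⟩
          exact hl w ((hmS w).2 hw) hyw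
        · rintro rfl
          exact ⟨(hmS _).1 hz, hyz⟩
      have h2 := hsk y ((hmS y).1 hy) (by rw [h1]; simp) z ((hmS z).1 hz) hyz
      obtain ⟨a, b, hab, he⟩ := Set.ncard_eq_two.1 h2
      have hy' : y ∈ ({a, b} : Set V) := by rw [← he]; exact ⟨(hmS y).1 hy, hyz.symm⟩
      have ha' : a ∈ {w | w ∈ S' ∧ T.Adj z w} := by rw [he]; simp
      have hb' : b ∈ {w | w ∈ S' ∧ T.Adj z w} := by rw [he]; simp
      have hall : ∀ w ∈ S, T.Adj z w → w = a ∨ w = b := by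
        intro w hw hzw
        have : w ∈ ({a, b} : Set V) := by rw [← he]; exact ⟨(hmS w).1 hw, hzw⟩
        simpa using this
      rcases hy' with rfl | hyb
      · exact ⟨b, (hmS b).2 hb'.1, hab.symm, hb'.2, hall⟩
      · rw [Set.mem_singleton_iff] at hyb
        subst hyb
        exact ⟨a, (hmS a).2 ha'.1, hab, ha'.2, fun w hw h => (hall w hw h).symm⟩
  have := Cfg.bound hT n S ∅ _ _ _ hn2 C
  rw [Finset.card_insert_of_notMem hx] at this
  simp at this
  exact this

/-- A rooted tree given by its parent function and its depth function. -/
structure Rooted {V : Type*} (q : V) (par : V → V) (d : V → ℕ) : Prop where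
  root : par q = q
  zero : ∀ v, d v = 0 → v = q
  depth : ∀ v, v ≠ q → d (par v) + 1 = d v

/-- `u` is an ancestor of `w` (possibly `u = w`). -/
def Anc {V : Type*} (par : V → V) (u w : V) : Prop := ∃ k : ℕ, par^[k] w = u

/-- The sets `A` and `B` overlap. -/
def Ov {V : Type*} (A B : Set V) : Prop := (A ∩ B).Nonempty ∧ ¬ A ⊆ B ∧ ¬ B ⊆ A

theorem Ov.symm {V : Type*} {A B : Set V} (h : Ov A B) : Ov B A :=
  ⟨by rw [Set.inter_comm]; exact h.1, h.2.2, h.2.1⟩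

section
variable {V : Type*} {q : V} {par : V → V} {d : V → ℕ}

theorem Anc.refl (u : V) : Anc par u u := ⟨0, rfl⟩

theorem Anc.parent (u : V) : Anc par (par u) u := ⟨1, rfl⟩

theorem Anc.trans {u v w : V} (h : Anc par u v) (h' : Anc par v w) : Anc par u w := by
  obtain ⟨k, hk⟩ := h
  obtain ⟨l, hl⟩ := h'
  exact ⟨k + l, by rw [Function.iterate_add_apply, hl, hk]⟩

theorem Anc.cases {u w : V} (h : Anc par u w) : u = w ∨ Anc par u (par w) := by
  obtain ⟨k, hk⟩ := h
  cases k with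
  | zero => exact Or.inl hk.symm
  | succ k => exact Or.inr ⟨k, by rwa [Function.iterate_succ_apply] at hk⟩

theorem Anc.chain {u v w : V} (h : Anc par u w) (h' : Anc par v w) :
    Anc par u v ∨ Anc par v u := by
  obtain ⟨k, hk⟩ := h
  obtain ⟨l, hl⟩ := h'
  rcases le_total k l with hkl | hkl
  · obtain ⟨m, rfl⟩ := Nat.exists_eq_add_of_le hkl
    right
    refine ⟨m, ?_⟩
    rw [← hk, ← Function.iterate_add_apply, add_comm, hl]
  · obtain ⟨m, rfl⟩ := Nat.exists_eq_add_of_le hkl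
    left
    refine ⟨m, ?_⟩
    rw [← hl, ← Function.iterate_add_apply, add_comm, hk]

namespace Rooted

theorem anc_lt (R : Rooted q par d) {u w : V} (h : Anc par u w) : u = w ∨ d u < d w := by
  obtain ⟨k, hk⟩ := h
  induction k generalizing w with
  | zero => exact Or.inl hk.symm
  | succ k ih =>
    rw [Function.iterate_succ_apply] at hk
    by_cases hw : w = q
    · subst hw
      rw [R.root] at hk
      exact ih hk
    · have := R.depth w hw
      rcases ih hk with h | h
      · subst h
        right
        omega
      · right
        omega

theorem antisymm (R : Rooted q par d) {u w : V} (h : Anc par u w) (h' : Anc par w u) :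
    u = w := by
  rcases R.anc_lt h with h1 | h1
  · exact h1
  · rcases R.anc_lt h' with h2 | h2
    · exact h2.symm
    · omega

theorem anc_root (R : Rooted q par d) (w : V) : Anc par q w := by
  obtain ⟨n, hn⟩ : ∃ n, d w = n := ⟨_, rfl⟩
  induction n generalizing w with
  | zero => rw [R.zero w hn]; exact Anc.refl q
  | succ n ih =>
    by_cases hw : w = q
    · rw [hw]; exact Anc.refl q
    · have := R.depth w hw
      exact (ih (par w) (by omega)).trans (Anc.parent w)

theorem not_anc_par (R : Rooted q par d) {u : V} (hu : u ≠ q) : ¬ Anc par u (par u) := by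
  intro h
  have := R.depth u hu
  rcases R.anc_lt h with h1 | h1
  · rw [← h1] at this
    omega
  · omega

theorem anc_child (R : Rooted q par d) {a w : V} (h : Anc par a w) (haw : a ≠ w) :
    ∃ t, t ≠ q ∧ par t = a ∧ Anc par t w := by
  obtain ⟨k, hk⟩ := h
  induction k generalizing w with
  | zero => exact absurd hk.symm haw
  | succ k ih =>
    rw [Function.iterate_succ_apply] at hk
    by_cases h : a = par w
    · refine ⟨w, ?_, h.symm, Anc.refl w⟩
      rintro rfl
      exact haw (h.trans R.root)
    · obtain ⟨t, h1, h2, h3⟩ := ih h hk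
      exact ⟨t, h1, h2, h3.trans (Anc.parent w)⟩

theorem sibling (R : Rooted q par d) {t v w : V} (ht : t ≠ q) (hv : v ≠ q)
    (htv : par t = par v) (h : Anc par t w) (h' : Anc par v w) : t = v := by
  rcases h.chain h' with h | h
  · rcases h.cases with h | h
    · exact h
    · rw [← htv] at h
      exact absurd h (R.not_anc_par ht)
  · rcases h.cases with h | h
    · exact h.symm
    · rw [htv] at h
      exact absurd h (R.not_anc_par hv)

end Rooted

/-- Members of `S` below `u`. -/
def Bel (S : Set V) (par : V → V) (u : V) : Set V := {w | w ∈ S ∧ Anc par u w}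

/-- The set assigned to an internal vertex. -/
def Gs (S : Set V) (q : V) (par : V → V) (e : V → ℕ) (u : V) : Set V :=
  {w | w ∈ S ∧ (w = par u ∨ (∃ v, v ≠ q ∧ par v = par u ∧ e v < e u ∧ Anc par v w) ∨
    (Anc par u w ∧ w ≠ u))}

variable {S : Set V} {e : V → ℕ}

theorem Gs_sub {u : V} : Gs S q par e u ⊆ Bel S par (par u) := by
  rintro w ⟨hw, rfl | ⟨v, -, h1, -, h2⟩ | ⟨h, -⟩⟩
  · exact ⟨hw, Anc.refl _⟩
  · exact ⟨hw, h1 ▸ (Anc.parent v).trans h2⟩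
  · exact ⟨hw, (Anc.parent u).trans h⟩

theorem Bel_mono {u v : V} (h : Anc par u v) : Bel S par v ⊆ Bel S par u :=
  fun _ hw => ⟨hw.1, h.trans hw.2⟩

theorem Bel_disj {u v : V} (h : ¬ Anc par u v) (h' : ¬ Anc par v u) {w : V}
    (h1 : w ∈ Bel S par u) (h2 : w ∈ Bel S par v) : False :=
  (h1.2.chain h2.2).elim h h'

theorem not_ov_of_sub {A B : Set V} (h : A ⊆ B) : ¬ Ov A B := fun h' => h'.2.1 h

theorem not_ov_of_sup {A B : Set V} (h : B ⊆ A) : ¬ Ov A B := fun h' => h'.2.2 h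

theorem not_ov_of_disj {A B : Set V} (h : ∀ w ∈ A, w ∉ B) : ¬ Ov A B := by
  rintro ⟨⟨w, h1, h2⟩, -⟩
  exact h w h1 h2

theorem not_ov_Bel (u v : V) : ¬ Ov (Bel S par u) (Bel S par v) := by
  by_cases h : Anc par u v
  · exact not_ov_of_sup (Bel_mono h)
  · by_cases h' : Anc par v u
    · exact not_ov_of_sub (Bel_mono h')
    · exact not_ov_of_disj fun w h1 h2 => Bel_disj h h' h1 h2

theorem Rooted.incomp (R : Rooted q par d) (he : Function.Injective e) {u v : V} (hu : u ≠ q)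
    (h1 : ¬ Anc par u v) (h2 : ¬ Anc par v (par u)) :
    Bel S par v ⊆ Gs S q par e u ∨ ∀ w ∈ Gs S q par e u, w ∉ Bel S par v := by
  by_cases h : Anc par (par u) v
  · have hne : par u ≠ v := by
      intro h'
      rw [h'] at h2
      exact h2 (Anc.refl v)
    obtain ⟨t, ht, htu, htv⟩ := R.anc_child h hne
    have htne : t ≠ u := by
      rintro rfl
      exact h1 htv
    rcases lt_or_gt_of_ne (fun h => htne (he h)) with hlt | hlt
    · left
      intro w hw
      exact ⟨hw.1, Or.inr (Or.inl ⟨t, ht, htu, hlt, htv.trans hw.2⟩)⟩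
    · right
      rintro w ⟨hw, hw'⟩ hwv
      have htw := htv.trans hwv.2
      rcases hw' with rfl | ⟨v', hv', h3, h4, h5⟩ | ⟨h5, -⟩
      · rw [← htu] at htw
        exact R.not_anc_par ht htw
      · have := R.sibling ht hv' (htu.trans h3.symm) htw h5
        subst this
        omega
      · exact htne (R.sibling ht hu htu htw h5)
  · right
    intro w hw hwv
    exact Bel_disj h h2 (Gs_sub hw) hwv

theorem Rooted.ov_Bel (R : Rooted q par d) (he : Function.Injective e) {u v : V} (hu : u ≠ q)
    (huS : u ∈ S) (hpS : par u ∈ S) (hc : ∃ c ∈ S, c ≠ q ∧ par c = u) :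
    Ov (Gs S q par e u) (Bel S par v) ↔ u = v := by
  constructor
  · intro h
    by_contra huv
    by_cases h1 : Anc par u v
    · refine not_ov_of_sup ?_ h
      intro w hw
      refine ⟨hw.1, Or.inr (Or.inr ⟨h1.trans hw.2, ?_⟩)⟩
      rintro rfl
      exact huv (R.antisymm h1 hw.2)
    · by_cases h2 : Anc par v (par u)
      · exact not_ov_of_sub (Gs_sub.trans (Bel_mono h2)) h
      · rcases R.incomp he hu h1 h2 with h3 | h3
        · exact not_ov_of_sup h3 h
        · exact not_ov_of_disj h3 h
  · rintro rfl
    obtain ⟨c, hcS, hcq, hcu⟩ := hc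
    have huc : Anc par u c := hcu ▸ Anc.parent c
    refine ⟨⟨c, ⟨hcS, Or.inr (Or.inr ⟨huc, ?_⟩)⟩, hcS, huc⟩, ?_, ?_⟩
    · rintro rfl
      have := R.depth c hcq
      rw [hcu] at this
      omega
    · intro h
      have : par u ∈ Bel S par u := h ⟨hpS, Or.inl rfl⟩
      exact R.not_anc_par hu this.2
    · intro h
      have : u ∈ Gs S q par e u := h ⟨huS, Anc.refl u⟩
      rcases this with ⟨-, h | ⟨v, hv, h1, h2, h3⟩ | ⟨-, h⟩⟩
      · have h4 := R.not_anc_par hu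
        rw [← h] at h4
        exact h4 (Anc.refl u)
      · have := R.sibling hv hu h1 h3 (Anc.refl u)
        subst this
        omega
      · exact h rfl

theorem Rooted.ov_Gs_par (R : Rooted q par d) {u v : V} (hu : u ≠ q) (hv : v ≠ q)
    (hvS : v ∈ S) (hpS : par v ∈ S) (hc : ∃ c ∈ S, c ≠ q ∧ par c = u) (huv : par u = v) :
    Ov (Gs S q par e u) (Gs S q par e v) := by
  obtain ⟨c, hcS, hcq, hcu⟩ := hc
  have huc : Anc par u c := hcu ▸ Anc.parent c
  have hvu : Anc par v u := huv ▸ Anc.parent u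
  have d1 := R.depth c hcq
  have d2 := R.depth u hu
  have d3 := R.depth v hv
  rw [hcu] at d1
  rw [huv] at d2
  refine ⟨⟨c, ⟨hcS, Or.inr (Or.inr ⟨huc, ?_⟩)⟩, hcS, Or.inr (Or.inr ⟨hvu.trans huc, ?_⟩)⟩, ?_, ?_⟩
  · rintro rfl
    omega
  · rintro rfl
    omega
  · intro h
    have : v ∈ Gs S q par e v := h ⟨hvS, Or.inl huv.symm⟩
    rcases this with ⟨-, h | ⟨t, ht, h1, h2, h3⟩ | ⟨-, h⟩⟩
    · rw [← h] at d3
      omega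
    · have := R.sibling ht hv h1 h3 (Anc.refl v)
      subst this
      omega
    · exact h rfl
  · intro h
    have : par v ∈ Gs S q par e u := h ⟨hpS, Or.inl rfl⟩
    have := (Gs_sub this).2
    rw [huv] at this
    exact R.not_anc_par hv this

theorem Rooted.Gs_desc (R : Rooted q par d) {u v : V} (huv : u ≠ v) (hp : par v ≠ u)
    (h : Anc par u v) : Gs S q par e v ⊆ Gs S q par e u := by
  have hup : Anc par u (par v) := h.cases.resolve_left huv
  intro w hw
  have hpw := (Gs_sub hw).2
  refine ⟨hw.1, Or.inr (Or.inr ⟨hup.trans hpw, ?_⟩)⟩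
  rintro rfl
  exact hp (R.antisymm hpw hup)

theorem Rooted.not_ov_Gs (R : Rooted q par d) (he : Function.Injective e) {u v : V}
    (hu : u ≠ q) (hv : v ≠ q) (huv : u ≠ v) (h1 : par u ≠ v) (h2 : par v ≠ u) :
    ¬ Ov (Gs S q par e u) (Gs S q par e v) := by
  by_cases h3 : Anc par u v
  · exact not_ov_of_sup (R.Gs_desc huv h2 h3)
  by_cases h4 : Anc par v u
  · exact not_ov_of_sub (R.Gs_desc huv.symm h1 h4)
  by_cases h5 : par u = par v
  · have key : ∀ u v : V, u ≠ q → par u = par v → e u < e v →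
        Gs S q par e u ⊆ Gs S q par e v := by
      rintro u v hu huv hlt w ⟨hw, h | ⟨t, ht, h1, h2, h3⟩ | ⟨h, -⟩⟩
      · exact ⟨hw, Or.inl (h.trans huv)⟩
      · exact ⟨hw, Or.inr (Or.inl ⟨t, ht, h1.trans huv, h2.trans hlt, h3⟩)⟩
      · exact ⟨hw, Or.inr (Or.inl ⟨u, hu, huv, hlt, h⟩)⟩
    rcases lt_or_gt_of_ne (fun h => huv (he h)) with hlt | hlt
    · exact not_ov_of_sub (key u v hu h5 hlt)
    · exact not_ov_of_sup (key v u hv h5.symm hlt)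
  have key : ∀ u v : V, u ≠ q → ¬ Anc par u v → ¬ Anc par (par v) (par u) →
      ¬ Ov (Gs S q par e u) (Gs S q par e v) := by
    intro u v hu h1 h2
    rcases R.incomp (S := S) he hu (fun h => h1 (h.trans (Anc.parent v))) h2 with h3 | h3
    · exact not_ov_of_sup (Gs_sub.trans h3)
    · exact not_ov_of_disj fun w hw hw' => h3 w hw (Gs_sub hw')
  by_cases h6 : Anc par (par v) (par u)
  · intro h
    exact key v u hv h4 (fun h7 => h5 (R.antisymm h7 h6)) h.symm
  · exact key u v hu h3 h6

end

/-- The choice of the root: a leaf `q` at the end of a longest path. -/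
theorem exists_root {V : Type*} [Fintype V] {T : SimpleGraph V} (hT : T.IsTree)
    (hn : 3 ≤ Fintype.card V) : ∃ q r : V, T.Adj q r ∧ (∀ a, T.Adj q a → a = r) ∧
      ∀ c c' x x', T.Adj r c → T.Adj r c' → T.Adj c x → T.Adj c' x' → x ≠ r → x' ≠ r → c = c' := by
  classical
  obtain ⟨s, b, hsb⟩ := Fintype.exists_pair_of_one_lt_card (α := V) (by omega)
  obtain ⟨q, -, hmax⟩ := Finset.univ.exists_max_image (fun w => T.dist s w) ⟨s, Finset.mem_univ s⟩
  have hqs : q ≠ s := by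
    rintro rfl
    have h1 : T.dist q b ≤ T.dist q q := hmax b (Finset.mem_univ b)
    have h3 := hT.connected.pos_dist_of_ne hsb
    rw [T.dist_self] at h1
    omega
  obtain ⟨par, -, hd, hadj⟩ := tree_rooted hT s
  have hqr : T.Adj q (par q) := (hadj _ _).2 (Or.inl ⟨hqs, rfl⟩)
  have hdq := hd q hqs
  have hm : ∀ w, T.dist s w ≤ T.dist s q := fun w => hmax w (Finset.mem_univ w)
  refine ⟨q, par q, hqr, fun a ha => tree_fact hT ha hqr (hm a) (hm _), ?_⟩
  have key : ∀ c x, T.Adj (par q) c → T.Adj c x → x ≠ par q → T.dist s c ≤ T.dist s (par q) := by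
    intro c x hc hx hne
    by_contra hlt
    have := hm x
    exact hne (tree_fact hT (z := s) hx hc.symm (by omega) (by omega))
  intro c c' x x' hc hc' hx hx' hne hne'
  exact tree_fact hT hc hc' (key c x hc hx hne) (key c' x' hc' hx' hne')

theorem upper_bound {V : Type*} [Fintype V] {T : SimpleGraph V} (hT : T.IsTree)
    (hn : 3 ≤ Fintype.card V) : ∃ (S : Set V) (f : V → Finset ℕ),
      IsSkeletonIn T S ∧ IsOverlapRep T f ∧ repSize f ≤ S.ncard := by
  classical
  obtain ⟨q, r, hqr, hq1, hr1⟩ := exists_root hT hn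
  obtain ⟨par, hroot, hd, hadj⟩ := tree_rooted hT q
  have R : Rooted q par (T.dist q) := by
    refine ⟨hroot, fun v hv => ?_, hd⟩
    by_contra hne
    have := hT.connected.pos_dist_of_ne (Ne.symm hne)
    omega
  have hrq : r ≠ q := hqr.ne'
  have hpr : par r = q := by
    rcases (hadj q r).1 hqr with h | h
    · exact absurd rfl h.1
    · exact h.2
  have hq2 : ∀ v, v ≠ q → par v = q → v = r := fun v hv h =>
    hq1 v ((hadj q v).2 (Or.inr ⟨hv, h⟩))
  have hpne : ∀ v, v ≠ q → par v ≠ v := by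
    intro v hv h
    have := hd v hv
    rw [h] at this
    omega
  -- internal vertices
  obtain ⟨N, hN⟩ : ∃ N : V → Prop, ∀ v, N v ↔ v ≠ q ∧ ∃ c, c ≠ q ∧ par c = v :=
    ⟨_, fun _ => Iff.rfl⟩
  have hNr : N r := by
    refine (hN r).2 ⟨hrq, ?_⟩
    obtain ⟨z, hz⟩ : ∃ z, z ∉ ({q, r} : Finset V) := by
      by_contra! h
      have h1 : (Finset.univ : Finset V) ⊆ {q, r} := fun z _ => h z
      have h2 := Finset.card_le_card h1
      have h3 := Finset.card_le_two (a := q) (b := r)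
      rw [Finset.card_univ] at h2
      omega
    simp only [Finset.mem_insert, Finset.mem_singleton, not_or] at hz
    obtain ⟨t, ht, htq, htz⟩ := R.anc_child (R.anc_root z) (Ne.symm hz.1)
    have := hq2 t ht htq
    subst this
    obtain ⟨c, hc, hct, -⟩ := R.anc_child htz (Ne.symm hz.2)
    exact ⟨c, hc, hct⟩
  have hNpar : ∀ v, v ≠ q → par v = q ∨ N (par v) := by
    intro v hv
    by_cases h : par v = q
    · exact Or.inl h
    · exact Or.inr ((hN _).2 ⟨h, v, hv, rfl⟩)
  have hNleaf : ∀ v, v ≠ q → ¬ N v → N (par v) := by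
    intro v hv hnv
    refine (hNpar v hv).resolve_left fun h => hnv ?_
    rw [hq2 v hv h]
    exact hNr
  have hb : ∀ u, ∃ b, N u → b ≠ q ∧ par b = u := by
    intro u
    by_cases h : N u
    · obtain ⟨c, hc⟩ := ((hN u).1 h).2
      exact ⟨c, fun _ => hc⟩
    · exact ⟨u, fun h' => absurd h' h⟩
  choose b hb using hb
  obtain ⟨S, hS⟩ : ∃ S : Set V, ∀ v, v ∈ S ↔ v = q ∨ N v ∨
      (v ≠ q ∧ v = b (par v) ∧ ∀ c, c ≠ q → par c = par v → ¬ N c) := ⟨{v | _}, fun _ => Iff.rfl⟩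
  have hqS : q ∈ S := (hS q).2 (Or.inl rfl)
  have hNS : ∀ v, N v → v ∈ S := fun v h => (hS v).2 (Or.inr (Or.inl h))
  have hparS : ∀ v, par v ∈ S := by
    intro v
    by_cases hv : v = q
    · rw [hv, hroot]; exact hqS
    · rcases hNpar v hv with h | h
      · rw [h]; exact hqS
      · exact hNS _ h
  have hchild : ∀ u, N u → ∃ c ∈ S, c ≠ q ∧ par c = u := by
    intro u hu
    by_cases h : ∃ c, c ≠ q ∧ par c = u ∧ N c
    · obtain ⟨c, hc, hcu, hNc⟩ := h
      exact ⟨c, hNS c hNc, hc, hcu⟩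
    · obtain ⟨h1, h2⟩ := hb u hu
      refine ⟨b u, (hS _).2 (Or.inr (Or.inr ⟨h1, by rw [h2], ?_⟩)), h1, h2⟩
      intro c hc hcu hNc
      rw [h2] at hcu
      exact h ⟨c, hc, hcu, hNc⟩
  have hskel : IsSkeletonIn T S := by
    constructor
    · rw [SimpleGraph.connected_iff_exists_forall_reachable]
      refine ⟨⟨q, hqS⟩, ?_⟩
      rintro ⟨w, hw⟩
      obtain ⟨n, hn⟩ : ∃ n, T.dist q w = n := ⟨_, rfl⟩
      induction n generalizing w with
      | zero =>
        have := R.zero w hn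
        subst this
        exact SimpleGraph.Reachable.refl _
      | succ n ih =>
        have hwq : w ≠ q := by
          rintro rfl
          rw [T.dist_self] at hn
          omega
        have := hd w hwq
        refine (ih (par w) (hparS w) (by omega)).trans (SimpleGraph.Adj.reachable ?_)
        rw [SimpleGraph.comap_adj]
        exact (hadj _ _).2 (Or.inr ⟨hwq, rfl⟩)
    · intro x hx hx1 y hy hxy
      have hNx : ¬ N x := by
        intro hNx
        have hxq := ((hN x).1 hNx).1
        obtain ⟨a, ha⟩ := Set.ncard_eq_one.1 hx1
        obtain ⟨c, hcS, hcq, hcx⟩ := hchild x hNx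
        have h1 : par x ∈ ({a} : Set V) := by
          rw [← ha]
          exact ⟨hparS x, (hadj _ _).2 (Or.inl ⟨hxq, rfl⟩)⟩
        have h2 : c ∈ ({a} : Set V) := by
          rw [← ha]
          exact ⟨hcS, (hadj _ _).2 (Or.inr ⟨hcq, hcx⟩)⟩
        have h3 : par x = c := h1.trans h2.symm
        have h4 := hd x hxq
        have h5 := hd c hcq
        rw [hcx] at h5
        rw [h3] at h4
        omega
      -- it suffices to know that `y` has exactly one child in `S`
      have key : ∀ y c, N y → c ∈ S → c ≠ q → par c = y →
          (∀ c' ∈ S, c' ≠ q → par c' = y → c' = c) → {z | z ∈ S ∧ T.Adj y z}.ncard = 2 := by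
        intro y c hNy hcS hcq hcy huniq
        have hyq := ((hN y).1 hNy).1
        refine Set.ncard_eq_two.2 ⟨par y, c, ?_, ?_⟩
        · intro h
          have h4 := hd y hyq
          have h5 := hd c hcq
          rw [hcy] at h5
          rw [h] at h4
          omega
        · ext z
          constructor
          · rintro ⟨hz, hyz⟩
            rcases (hadj _ _).1 hyz with h | h
            · exact Or.inl h.2.symm
            · exact Or.inr (huniq z hz h.1 h.2)
          · rintro (rfl | rfl)
            · exact ⟨hparS y, (hadj _ _).2 (Or.inl ⟨hyq, rfl⟩)⟩
            · exact ⟨hcS, (hadj _ _).2 (Or.inr ⟨hcq, hcy⟩)⟩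
      by_cases hxq : x = q
      · subst hxq
        have hyr := hq1 y hxy
        subst hyr
        obtain ⟨c, hcS, hcq, hcy⟩ := hchild y hNr
        refine key y c hNr hcS hcq hcy ?_
        intro c' hc'S hc'q hc'y
        have aux : ∀ c, N c → c ≠ x → par c = y → T.Adj y c ∧ ∃ z, T.Adj c z ∧ z ≠ y := by
          intro c hc hcx hcy
          refine ⟨(hadj _ _).2 (Or.inr ⟨hcx, hcy⟩), ?_⟩
          obtain ⟨z, hzx, hzc⟩ := ((hN c).1 hc).2
          refine ⟨z, (hadj _ _).2 (Or.inr ⟨hzx, hzc⟩), ?_⟩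
          rintro rfl
          exact hcx (hzc.symm.trans hpr)
        rcases ((hS c).1 hcS).resolve_left hcq with h1 | ⟨-, h1, h1'⟩
        · rcases ((hS c').1 hc'S).resolve_left hc'q with h2 | ⟨-, h2, h2'⟩
          · obtain ⟨h3, z, h4, h5⟩ := aux c h1 hcq hcy
            obtain ⟨h3', z', h4', h5'⟩ := aux c' h2 hc'q hc'y
            exact hr1 _ _ _ _ h3' h3 h4' h4 h5' h5
          · exact absurd h1 (h2' c hcq (hcy.trans hc'y.symm))
        · rcases ((hS c').1 hc'S).resolve_left hc'q with h2 | ⟨-, h2, h2'⟩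
          · exact absurd h2 (h1' c' hc'q (hc'y.trans hcy.symm))
          · rw [h1, h2, hcy, hc'y]
      · obtain ⟨-, h1, h1'⟩ := (((hS x).1 hx).resolve_left hxq).resolve_left hNx
        have hxy' : par x = y := by
          rcases (hadj _ _).1 hxy with h | h
          · exact h.2
          · exact absurd ((hN x).2 ⟨hxq, y, h⟩) hNx
        have hNy : N y := hxy' ▸ hNleaf x hxq hNx
        refine key y x hNy hx hxq hxy' ?_
        intro c' hc'S hc'q hc'y
        rcases ((hS c').1 hc'S).resolve_left hc'q with h2 | ⟨-, h2, h2'⟩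
        · exact absurd h2 (h1' c' hc'q (hc'y.trans hxy'.symm))
        · rw [h1, h2, hxy', hc'y]
  obtain ⟨e, he⟩ : ∃ e : V → ℕ, Function.Injective e :=
    ⟨fun v => (Fintype.equivFin V v : ℕ), fun a b h =>
      (Fintype.equivFin V).injective (Fin.ext h)⟩
  obtain ⟨h, hh⟩ : ∃ h : V → V, ∀ v, h v = if v = q then r else par v := ⟨_, fun _ => rfl⟩
  have hhN : ∀ v, ¬ N v → N (h v) := by
    intro v hv
    rw [hh]
    split_ifs with hvq
    · exact hNr
    · exact hNleaf v hvq hv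
  have hhadj : ∀ v u, ¬ N v → (T.Adj v u ↔ u = h v) := by
    intro v u hv
    rw [hh]
    split_ifs with hvq
    · subst hvq
      exact ⟨hq1 u, fun h => h ▸ hqr⟩
    · constructor
      · intro hvu
        rcases (hadj _ _).1 hvu with h | h
        · exact h.2.symm
        · exact absurd ((hN v).2 ⟨hvq, u, h⟩) hv
      · intro h
        exact (hadj _ _).2 (Or.inl ⟨hvq, h.symm⟩)
  obtain ⟨g, hg⟩ : ∃ g : V → Set V, ∀ v, g v = if N v then Gs S q par e v
    else Bel S par (h v) := ⟨_, fun _ => rfl⟩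
  have hgS : ∀ v, g v ⊆ S := by
    intro v w hw
    rw [hg] at hw
    split_ifs at hw
    · exact hw.1
    · exact hw.1
  have hmix : ∀ u v, N u → ¬ N v → (T.Adj v u ↔ Ov (g u) (g v)) := by
    intro u v hu hv
    rw [hhadj v u hv, hg u, hg v, if_pos hu, if_neg hv,
      R.ov_Bel he ((hN u).1 hu).1 (hNS u hu) (hparS u) (hchild u hu)]
  have hov : ∀ u v, u ≠ v → (T.Adj u v ↔ Ov (g u) (g v)) := by
    intro u v huv
    by_cases hu : N u <;> by_cases hv : N v
    · have huq := ((hN u).1 hu).1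
      have hvq := ((hN v).1 hv).1
      rw [hg u, hg v, if_pos hu, if_pos hv]
      constructor
      · intro h
        rcases (hadj _ _).1 h with h | h
        · exact R.ov_Gs_par huq hvq (hNS v hv) (hparS v) (hchild u hu) h.2
        · exact (R.ov_Gs_par hvq huq (hNS u hu) (hparS u) (hchild v hv) h.2).symm
      · intro h
        by_contra hna
        refine R.not_ov_Gs he huq hvq huv ?_ ?_ h
        · exact fun h => hna ((hadj _ _).2 (Or.inl ⟨huq, h⟩))
        · exact fun h => hna ((hadj _ _).2 (Or.inr ⟨hvq, h⟩))
    · rw [T.adj_comm]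
      exact hmix u v hu hv
    · rw [hmix v u hv hu]
      exact ⟨Ov.symm, Ov.symm⟩
    · rw [hg u, hg v, if_neg hu, if_neg hv]
      refine iff_of_false ?_ (not_ov_Bel _ _)
      intro h
      apply hv
      rw [(hhadj u v hu).1 h]
      exact hhN u hu
  have hmf : ∀ v w, e w ∈ (g v).toFinset.image e ↔ w ∈ g v := by
    intro v w
    rw [Finset.mem_image]
    constructor
    · rintro ⟨w', h1, h2⟩
      rw [← he h2]
      simpa using h1
    · intro h
      exact ⟨w, by simpa using h, rfl⟩
  have hsubf : ∀ u v, (g u).toFinset.image e ⊆ (g v).toFinset.image e ↔ g u ⊆ g v := by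
    intro u v
    rw [Finset.image_subset_image_iff he, Set.toFinset_subset_toFinset]
  refine ⟨S, fun v => (g v).toFinset.image e, hskel, ?_, ?_⟩
  · intro u v huv
    rw [hov u v huv, hsubf, hsubf]
    unfold Ov
    refine and_congr_left fun _ => ?_
    rw [← Finset.image_inter _ _ he, Finset.image_nonempty, ← Set.toFinset_inter,
      Set.toFinset_nonempty]
  · unfold repSize
    rw [← Set.ncard_image_of_injective S he]
    refine Set.ncard_le_ncard ?_ (Set.toFinite _)
    intro t ht
    simp only [Finset.coe_image, Set.coe_toFinset, Set.mem_iUnion] at ht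
    obtain ⟨v, w, hw, rfl⟩ := ht
    exact ⟨w, hgS v hw, rfl⟩

end OverlapTree
theorem stmt_5 {V : Type*} [Fintype V] (T : SimpleGraph V) (hT : T.IsTree)
    (hn : 3 ≤ Fintype.card V) :
    overlapNumber T = sSup {k : ℕ | ∃ S : Set V, IsSkeletonIn T S ∧ S.ncard = k} := by
  obtain ⟨S, f, hS, hf, hle⟩ := OverlapTree.upper_bound hT hn
  have hbdd : BddAbove {k : ℕ | ∃ S : Set V, IsSkeletonIn T S ∧ S.ncard = k} := by
    refine ⟨repSize f, ?_⟩
    rintro k ⟨S', hS', rfl⟩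
    exact OverlapTree.lower_bound hT hn hf hS'
  apply le_antisymm
  · refine le_trans (Nat.sInf_le ⟨f, hf, rfl⟩) (hle.trans ?_)
    exact le_csSup hbdd ⟨S, hS, rfl⟩
  · refine csSup_le ⟨_, S, hS, rfl⟩ ?_
    rintro k ⟨S', hS', rfl⟩
    obtain ⟨f', hf', hsz⟩ := Nat.sInf_mem
      (s := {n | ∃ f : V → Finset ℕ, IsOverlapRep T f ∧ repSize f = n}) ⟨_, f, hf, rfl⟩
    unfold overlapNumber
    rw [← hsz]
    exact OverlapTree.lower_bound hT hn hf' hS'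
end

section
/- If T is a skeleton (a tree in which the neighbor of every leaf has degree 2) with n ≥ 3 vertices, then every overlap representation of T has size at least n, i.e., φ(T) ≥ n. -/
namespace SkelOverlap

open Classical

variable {V α : Type*}

/-- neighbours of `v` inside `S` -/
noncomputable def nb (T : SimpleGraph V) (S : Finset V) (v : V) : Finset V :=
  S.filter (fun b => T.Adj v b)

def Conn (T : SimpleGraph V) (S : Finset V) : Prop :=
  ∀ A ⊆ S, A.Nonempty → (∀ a ∈ A, ∀ b ∈ S, T.Adj a b → b ∈ A) → A = S

def Skel (T : SimpleGraph V) (S : Finset V) : Prop :=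
  ∀ x ∈ S, (nb T S x).card = 1 → ∀ y ∈ S, T.Adj x y → (nb T S y).card = 2

def Cross (X : Finset α) (f g : Set α) : Prop :=
  (∃ x ∈ X, x ∈ f ∧ x ∈ g) ∧ (∃ x ∈ X, x ∈ f ∧ x ∉ g) ∧
  (∃ x ∈ X, x ∉ f ∧ x ∈ g) ∧ (∃ x ∈ X, x ∉ f ∧ x ∉ g)

def Rep (T : SimpleGraph V) (S : Finset V) (X : Finset α) (f : V → Set α) : Prop :=
  ∀ a ∈ S, ∀ b ∈ S, a ≠ b → (T.Adj a b ↔ Cross X (f a) (f b))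

def Goal (T : SimpleGraph V) (α : Type*) (S : Finset V) : Prop :=
  ∀ (X : Finset α) (f : V → Set α), Conn T S → Skel T S → 3 ≤ S.card →
    Rep T S X f → S.card + 1 ≤ X.card

def Forest (T : SimpleGraph V) : Prop :=
  ∀ S : Finset V, S.Nonempty → ∃ v ∈ S, (nb T S v).card ≤ 1

theorem mem_nb {T : SimpleGraph V} {S : Finset V} {v b : V} :
    b ∈ nb T S v ↔ b ∈ S ∧ T.Adj v b := by simp [nb]

theorem Cross.symm {X : Finset α} {f g : Set α} (h : Cross X f g) : Cross X g f := by
  obtain ⟨⟨a, ha⟩, ⟨b, hb⟩, ⟨c, hc⟩, ⟨d, hd⟩⟩ := h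
  exact ⟨⟨a, by tauto⟩, ⟨c, by tauto⟩, ⟨b, by tauto⟩, ⟨d, by tauto⟩⟩

theorem cross_comm {X : Finset α} {f g : Set α} : Cross X f g ↔ Cross X g f :=
  ⟨Cross.symm, Cross.symm⟩

theorem cross_compl_left {X : Finset α} {f g : Set α} : Cross X fᶜ g ↔ Cross X f g := by
  unfold Cross
  simp only [Set.mem_compl_iff, not_not]
  tauto

theorem cross_compl_right {X : Finset α} {f g : Set α} : Cross X f gᶜ ↔ Cross X f g := by
  rw [cross_comm, cross_compl_left, cross_comm]

theorem Cross.mono {X Y : Finset α} (hXY : X ⊆ Y) {f g : Set α} (h : Cross X f g) :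
    Cross Y f g := by
  obtain ⟨⟨a, ha⟩, ⟨b, hb⟩, ⟨c, hc⟩, ⟨d, hd⟩⟩ := h
  exact ⟨⟨a, hXY ha.1, ha.2⟩, ⟨b, hXY hb.1, hb.2⟩, ⟨c, hXY hc.1, hc.2⟩, ⟨d, hXY hd.1, hd.2⟩⟩

theorem Rep.compl {T : SimpleGraph V} {S : Finset V} {X : Finset α} {f g : V → Set α}
    (h : Rep T S X f) (hg : ∀ a, g a = f a ∨ g a = (f a)ᶜ) : Rep T S X g := by
  intro a ha b hb hab
  rw [h a ha b hb hab]
  rcases hg a with h1 | h1 <;> rcases hg b with h2 | h2 <;>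
    simp [h1, h2, cross_compl_left, cross_compl_right]

theorem Rep.restrict {T : SimpleGraph V} {S S' : Finset V} {X X' : Finset α} {f : V → Set α}
    (h : Rep T S X f) (hS : S' ⊆ S) (hX : X' ⊆ X)
    (hc : ∀ a ∈ S', ∀ b ∈ S', T.Adj a b → Cross X' (f a) (f b)) : Rep T S' X' f := by
  intro a ha b hb hab
  exact ⟨hc a ha b hb, fun h' => (h a (hS ha) b (hS hb) hab).2 (h'.mono hX)⟩

theorem Rep.cross {T : SimpleGraph V} {S : Finset V} {X : Finset α} {f : V → Set α}
    (h : Rep T S X f) {a b : V} (ha : a ∈ S) (hb : b ∈ S) (hab : T.Adj a b) :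
    Cross X (f a) (f b) := (h a ha b hb hab.ne).1 hab

theorem Conn.prune {T : SimpleGraph V} {S S' : Finset V} {w : V} (h : Conn T S) (hS : S' ⊆ S)
    (hw : w ∈ S') (hcl : ∀ a ∈ S', a ≠ w → ∀ b ∈ S, T.Adj a b → b ∈ S') : Conn T S' := by
  intro A hA hne hc
  by_cases hwA : w ∈ A
  · have := h (A ∪ (S \ S')) (by grind) (hne.mono Finset.subset_union_left) (by
      intro a ha b hb hab
      by_cases hbS : b ∈ S'
      · by_cases haA : a ∈ A
        · have := hc a haA b hbS hab
          grind
        · have : b = w := by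
            by_contra hbw
            have := hcl b hbS hbw a (by grind) hab.symm
            grind
          grind
      · grind)
    apply Finset.Subset.antisymm hA
    intro x hx
    have hxS : x ∈ A ∪ (S \ S') := by rw [this]; exact hS hx
    grind
  · have := h A (hA.trans hS) hne (by
      intro a ha b hb hab
      exact hc a ha b (hcl a (hA ha) (by grind) b hb hab) hab)
    subst this
    exact absurd (hS hw) hwA

theorem nb_prune {T : SimpleGraph V} {S S' : Finset V} {w : V} (hS : S' ⊆ S)
    (hcl : ∀ a ∈ S', a ≠ w → ∀ b ∈ S, T.Adj a b → b ∈ S') {a : V} (ha : a ∈ S') (haw : a ≠ w) :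
    nb T S' a = nb T S a := by
  ext b
  rw [mem_nb, mem_nb]
  exact ⟨fun h => ⟨hS h.1, h.2⟩, fun h => ⟨hcl a ha haw b h.1 h.2, h.2⟩⟩

/-- pruning at a vertex of degree at least three, keeping degree at least two -/
theorem Skel.prune {T : SimpleGraph V} {S S' : Finset V} {w : V} (h : Skel T S) (hS : S' ⊆ S)
    (hw : w ∈ S') (hcl : ∀ a ∈ S', a ≠ w → ∀ b ∈ S, T.Adj a b → b ∈ S')
    (h3 : 3 ≤ (nb T S w).card) (h2 : 2 ≤ (nb T S' w).card) : Skel T S' := by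
  intro x hx hx1 y hy hxy
  have hxw : x ≠ w := by rintro rfl; omega
  rw [nb_prune hS hcl hx hxw] at hx1
  have := h x (hS hx) hx1 y (hS hy) hxy
  have hyw : y ≠ w := by rintro rfl; omega
  rw [nb_prune hS hcl hy hyw]
  exact this

theorem Conn.exists_nb {T : SimpleGraph V} {S : Finset V} (h : Conn T S) (h2 : 2 ≤ S.card)
    {a : V} (ha : a ∈ S) : ∃ b ∈ S, T.Adj a b := by
  by_contra hcon
  push Not at hcon
  have := h {a} (by simpa using ha) (by simp) (by
    intro a' ha' b hb hab
    simp at ha'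
    subst ha'
    exact absurd hab (hcon b hb))
  rw [← this] at h2
  simp at h2

/-- The local configuration at a leaf `v`, its neighbour `u`, and the other neighbour `w` of `u`,
with all remaining sets disjoint from `f v`. -/
structure Config (T : SimpleGraph V) (S : Finset V) (X : Finset α) (f : V → Set α)
    (v u w : V) : Prop where
  conn : Conn T S
  skel : Skel T S
  rep : Rep T S X f
  card : 4 ≤ S.card
  hv : v ∈ S
  hu : u ∈ S
  hw : w ∈ S
  vu : T.Adj v u
  uw : T.Adj u w
  vw : v ≠ w
  nv : ∀ b ∈ S, T.Adj v b → b = u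
  nu : ∀ b ∈ S, T.Adj u b → b = v ∨ b = w
  disj : ∀ d ∈ S, d ≠ u → d ≠ v → ∀ x ∈ X, x ∈ f v → x ∉ f d

/-- Complementing the set of `u` preserves the configuration. -/
theorem Config.compl {T : SimpleGraph V} {S : Finset V} {X : Finset α} {f : V → Set α}
    {v u w : V} (h : Config T S X f v u w) :
    Config T S X (Function.update f u (f u)ᶜ) v u w := by
  have hvu : v ≠ u := h.vu.ne
  refine { h with rep := h.rep.compl ?_, disj := ?_ }
  · intro a
    by_cases ha : a = u
    · subst ha; simp
    · simp [Function.update_of_ne ha]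
  · intro d hd hdu hdv
    rw [Function.update_of_ne hdu, Function.update_of_ne hvu]
    exact h.disj d hd hdu hdv

theorem Config.dich {T : SimpleGraph V} {S : Finset V} {X : Finset α} {f : V → Set α}
    {v u w : V} (h : Config T S X f v u w) {d : V} (hd : d ∈ S) (hdu : d ≠ u) (hdv : d ≠ v)
    (hdw : d ≠ w) : (∀ x ∈ X, x ∈ f d → x ∈ f u) ∨ (∀ x ∈ X, x ∈ f d → x ∉ f u) := by
  by_contra hcon
  push Not at hcon
  obtain ⟨⟨x, hx, hxd, hxu⟩, y, hy, hyd, hyu⟩ := hcon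
  obtain ⟨⟨p, hp, hpv, hpu⟩, ⟨q, hq, hqv, hqu⟩, _⟩ := h.rep.cross h.hv h.hu h.vu
  have := (h.rep u h.hu d hd (Ne.symm hdu)).2
    ⟨⟨y, hy, hyu, hyd⟩, ⟨p, hp, hpu, h.disj d hd hdu hdv p hp hpv⟩, ⟨x, hx, hxu, hxd⟩,
      ⟨q, hq, hqu, h.disj d hd hdu hdv q hq hqv⟩⟩
  rcases h.nu d hd this with h | h <;> contradiction

/-- vertices on the `u` side, together with `w` -/
noncomputable def side (S : Finset V) (X : Finset α) (f : V → Set α) (v u w : V) : Finset V :=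
  S.filter (fun d => d ≠ u ∧ d ≠ v ∧ (d = w ∨ ∀ x ∈ X, x ∈ f d → x ∈ f u))

noncomputable def pts (X : Finset α) (f : V → Set α) (v u : V) : Finset α :=
  X.filter (fun x => x ∉ f v ∧ x ∈ f u)

theorem mem_side {S : Finset V} {X : Finset α} {f : V → Set α} {v u w d : V} :
    d ∈ side S X f v u w ↔
      d ∈ S ∧ d ≠ u ∧ d ≠ v ∧ (d = w ∨ ∀ x ∈ X, x ∈ f d → x ∈ f u) := by simp [side]

theorem mem_pts {X : Finset α} {f : V → Set α} {v u : V} {x : α} :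
    x ∈ pts X f v u ↔ x ∈ X ∧ x ∉ f v ∧ x ∈ f u := by simp [pts]

/-- closedness of a side -/
theorem Config.closed {T : SimpleGraph V} {S : Finset V} {X : Finset α} {f : V → Set α}
    {v u w : V} (h : Config T S X f v u w) :
    ∀ a ∈ side S X f v u w, a ≠ w → ∀ b ∈ S, T.Adj a b → b ∈ side S X f v u w := by
  intro a ha haw b hb hab
  rw [mem_side] at ha ⊢
  obtain ⟨haS, hau, hav, ha⟩ := ha
  have hbu : b ≠ u := by
    rintro rfl
    rcases h.nu a haS hab.symm with h | h <;> contradiction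
  have hbv : b ≠ v := by
    rintro rfl
    exact hau (h.nv a haS hab.symm)
  refine ⟨hb, hbu, hbv, ?_⟩
  by_cases hbw : b = w
  · exact Or.inl hbw
  right
  rcases h.dich hb hbu hbv hbw with h1 | h1
  · exact h1
  · obtain ⟨⟨x, hx, hxa, hxb⟩, _⟩ := h.rep.cross haS hb hab
    exact absurd ((ha.resolve_left haw) x hx hxa) (h1 x hx hxb)

/-- `w` has a neighbour in a nontrivial side -/
theorem Config.side_nb {T : SimpleGraph V} {S : Finset V} {X : Finset α} {f : V → Set α}
    {v u w : V} (h : Config T S X f v u w) {a : V} (ha : a ∈ side S X f v u w) (haw : a ≠ w) :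
    ∃ c ∈ side S X f v u w, c ≠ w ∧ T.Adj w c := by
  by_contra hcon
  push Not at hcon
  have := h.conn ((side S X f v u w).erase w) (by intro x; simp [mem_side]; tauto)
    ⟨a, by simp [ha, haw]⟩ (by
      intro a ha b hb hab
      rw [Finset.mem_erase] at ha ⊢
      have := h.closed a ha.2 ha.1 b hb hab
      refine ⟨?_, this⟩
      rintro rfl
      exact hcon a ha.2 ha.1 hab.symm)
  have hv := h.hv
  rw [← this] at hv
  simp [mem_side] at hv

theorem Config.side_card {T : SimpleGraph V} {S : Finset V} {X : Finset α} {f : V → Set α}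
    {v u w : V} (h : Config T S X f v u w) (IH : ∀ S' ⊂ S, Goal T α S')
    (h3 : 3 ≤ (nb T S w).card) {a : V} (ha : a ∈ side S X f v u w) (haw : a ≠ w)
    {b : V} (hbS : b ∈ S) (hbu : b ≠ u) (hbv : b ≠ v) (hb : b ∉ side S X f v u w) :
    (side S X f v u w).card ≤ (pts X f v u).card := by
  obtain ⟨c, hc, hcw, hwc⟩ := h.side_nb ha haw
  obtain ⟨⟨p, hp, hpv, hpu⟩, ⟨q, hq, hqv, hqu⟩, ⟨y, hy, hyv, hyu⟩, _⟩ := h.rep.cross h.hv h.hu h.vu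
  obtain ⟨_, _, ⟨z, hz, hzu, hzw⟩, _⟩ := h.rep.cross h.hu h.hw h.uw
  have hwu : w ≠ u := h.uw.ne.symm
  have hdis := h.disj
  have hzv : z ∉ f v := fun hzv => hdis w h.hw hwu h.vw.symm z hz hzv hzw
  set D := side S X f v u w with hD
  set S' := insert u (insert v D) with hS'
  set X' := insert z (insert p (insert q (pts X f v u))) with hX'
  have huD : u ∉ D := by simp [hD, mem_side]
  have hvD : v ∉ D := by simp [hD, mem_side]
  have hvu : v ≠ u := h.vu.ne
  have hDS : D ⊆ S := by intro x hx; exact (mem_side.1 hx).1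
  have hwD : w ∈ D := mem_side.2 ⟨h.hw, hwu, h.vw.symm, Or.inl rfl⟩
  have hS'S : S' ⊆ S := by
    have := h.hu
    have := h.hv
    grind
  have hcl : ∀ a ∈ S', a ≠ w → ∀ b ∈ S, T.Adj a b → b ∈ S' := by
    intro a ha haw b hb' hab
    rw [hS', Finset.mem_insert, Finset.mem_insert] at ha
    rcases ha with ha | ha | ha
    · rw [ha] at hab
      rcases h.nu b hb' hab with hh | hh <;> simp [hS', hwD, hh]
    · rw [ha] at hab
      rw [h.nv b hb' hab]; simp [hS']
    · have := h.closed a ha haw b hb' hab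
      simp [hS', hD, this]
  have hss : S' ⊂ S := by
    refine ⟨hS'S, fun hh => ?_⟩
    have := hh hbS
    simp [hS', hbu, hbv, hb] at this
  have hX'X : X' ⊆ X := by
    intro x hx
    simp only [hX', Finset.mem_insert, mem_pts] at hx
    rcases hx with rfl | rfl | rfl | hx <;> tauto
  have hconn : Conn T S' := h.conn.prune hS'S (by simp [hS', hwD]) hcl
  have hskel : Skel T S' := by
    refine h.skel.prune hS'S (by simp [hS', hwD]) hcl h3 ?_
    have : ({u, c} : Finset V) ⊆ nb T S' w := by
      intro x hx
      simp only [Finset.mem_insert, Finset.mem_singleton] at hx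
      rw [mem_nb]
      rcases hx with rfl | rfl
      · exact ⟨by simp [hS'], h.uw.symm⟩
      · exact ⟨by simp [hS', hc], hwc⟩
    have h2 := Finset.card_le_card this
    rwa [Finset.card_pair (by rintro rfl; exact huD hc)] at h2
  have hzX : z ∈ X' := by simp [hX']
  have hpX : p ∈ X' := by simp [hX']
  have hqX : q ∈ X' := by simp [hX']
  have hYX : ∀ x ∈ X, x ∉ f v → x ∈ f u → x ∈ X' := by
    intro x h1 h2 h3
    simp [hX', mem_pts, h1, h2, h3]
  have hyX : y ∈ X' := hYX y hy hyv hyu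
  have nvD : ∀ d ∈ D, ∀ x ∈ X, x ∈ f d → x ∉ f v := by
    intro d hd x hx hxd hxv
    rw [hD, mem_side] at hd
    exact hdis d hd.1 hd.2.1 hd.2.2.1 x hx hxv hxd
  have inu : ∀ d ∈ D, d ≠ w → ∀ x ∈ X, x ∈ f d → x ∈ f u := by
    intro d hd hdw
    rw [hD, mem_side] at hd
    exact hd.2.2.2.resolve_left hdw
  -- the crossing pairs
  have c1 : Cross X' (f v) (f u) :=
    ⟨⟨p, hpX, hpv, hpu⟩, ⟨q, hqX, hqv, hqu⟩, ⟨y, hyX, hyv, hyu⟩, ⟨z, hzX, hzv, hzu⟩⟩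
  have c2 : Cross X' (f u) (f w) := by
    obtain ⟨⟨x, hx, hxu, hxw⟩, _⟩ := h.rep.cross h.hu h.hw h.uw
    exact ⟨⟨x, hYX x hx (nvD w hwD x hx hxw) hxu, hxu, hxw⟩,
      ⟨p, hpX, hpu, fun hh => nvD w hwD p hp hh hpv⟩, ⟨z, hzX, hzu, hzw⟩,
      ⟨q, hqX, hqu, fun hh => nvD w hwD q hq hh hqv⟩⟩
  have c3 : ∀ d ∈ D, d ≠ w → T.Adj d w → Cross X' (f d) (f w) := by
    intro d hd hdw hadj
    obtain ⟨⟨x, hx, hxd, hxw⟩, ⟨x', hx', hxd', hxw'⟩, _⟩ := h.rep.cross (hDS hd) h.hw hadj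
    exact ⟨⟨x, hYX x hx (nvD d hd x hx hxd) (inu d hd hdw x hx hxd), hxd, hxw⟩,
      ⟨x', hYX x' hx' (nvD d hd x' hx' hxd') (inu d hd hdw x' hx' hxd'), hxd', hxw'⟩,
      ⟨z, hzX, fun hh => hzu (inu d hd hdw z hz hh), hzw⟩,
      ⟨q, hqX, fun hh => nvD d hd q hq hh hqv, fun hh => nvD w hwD q hq hh hqv⟩⟩
  have c4 : ∀ d ∈ D, d ≠ w → ∀ e ∈ D, e ≠ w → T.Adj d e → Cross X' (f d) (f e) := by
    intro d hd hdw e he hew hadj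
    obtain ⟨⟨x, hx, hxd, hxe⟩, ⟨x', hx', hxd', hxe'⟩, ⟨y, hy, hyd, hye⟩, _⟩ :=
      h.rep.cross (hDS hd) (hDS he) hadj
    exact ⟨⟨x, hYX x hx (nvD d hd x hx hxd) (inu d hd hdw x hx hxd), hxd, hxe⟩,
      ⟨x', hYX x' hx' (nvD d hd x' hx' hxd') (inu d hd hdw x' hx' hxd'), hxd', hxe'⟩,
      ⟨y, hYX y hy (nvD e he y hy hye) (inu e he hew y hy hye), hyd, hye⟩,
      ⟨q, hqX, fun hh => nvD d hd q hq hh hqv, fun hh => nvD e he q hq hh hqv⟩⟩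
  have hrep : Rep T S' X' f := by
    refine h.rep.restrict hS'S hX'X ?_
    intro a ha b hb hab
    have haS := hS'S ha
    have hbS := hS'S hb
    by_cases hav : a = v
    · subst hav
      rw [h.nv b hbS hab]; exact c1
    by_cases hbv : b = v
    · subst hbv
      rw [h.nv a haS hab.symm]; exact c1.symm
    by_cases hau : a = u
    · subst hau
      rw [(h.nu b hbS hab).resolve_left hbv]; exact c2
    by_cases hbu : b = u
    · subst hbu
      rw [(h.nu a haS hab.symm).resolve_left hav]; exact c2.symm
    have haD : a ∈ D := by simpa [hS', hav, hau] using ha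
    have hbD : b ∈ D := by simpa [hS', hbv, hbu] using hb
    by_cases haw : a = w
    · subst haw
      exact (c3 b hbD hab.ne.symm hab.symm).symm
    by_cases hbw : b = w
    · subst hbw
      exact c3 a haD haw hab
    exact c4 a haD haw b hbD hbw hab
  have hcardS : S'.card = D.card + 2 := by
    rw [hS', Finset.card_insert_of_notMem (by simp [huD, hvu.symm]),
      Finset.card_insert_of_notMem hvD]
  have hcardX : X'.card ≤ (pts X f v u).card + 3 := by
    rw [hX']
    refine (Finset.card_insert_le _ _).trans ?_
    refine Nat.succ_le_succ ((Finset.card_insert_le _ _).trans ?_)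
    exact Nat.succ_le_succ (Finset.card_insert_le _ _)
  have hDpos : 0 < D.card := Finset.card_pos.2 ⟨w, hwD⟩
  have := IH S' hss X' f hconn hskel (by omega) hrep
  omega

theorem Forest.no_triangle {T : SimpleGraph V} (hF : Forest T) {a b c : V} (hab : T.Adj a b)
    (hbc : T.Adj b c) (hac : T.Adj a c) : False := by
  obtain ⟨v, hv, h⟩ := hF {a, b, c} ⟨a, by simp⟩
  rw [Finset.card_le_one] at h
  simp only [mem_nb, Finset.mem_insert, Finset.mem_singleton] at hv h
  rcases hv with rfl | rfl | rfl
  · exact hbc.ne (h b ⟨by simp, hab⟩ c ⟨by simp, hac⟩)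
  · exact hac.ne (h a ⟨by simp, hab.symm⟩ c ⟨by simp, hbc⟩)
  · exact hab.ne (h a ⟨by simp, hac.symm⟩ b ⟨by simp, hbc.symm⟩)

/-- All remaining sets on the `u` side. -/
theorem Config.oneside {T : SimpleGraph V} {S : Finset V} {X : Finset α} {f : V → Set α}
    {v u w : V} (h : Config T S X f v u w) (hF : Forest T) (IH : ∀ S' ⊂ S, Goal T α S')
    (hall : ∀ d ∈ S, d ≠ u → d ≠ v → d ≠ w → ∀ x ∈ X, x ∈ f d → x ∈ f u) :
    S.card + 1 ≤ X.card := by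
  obtain ⟨⟨p, hp, hpv, hpu⟩, ⟨q, hq, hqv, hqu⟩, _⟩ := h.rep.cross h.hv h.hu h.vu
  obtain ⟨⟨t, ht, htu, htw⟩, _, ⟨z, hz, hzu, hzw⟩, _⟩ := h.rep.cross h.hu h.hw h.uw
  have hwu : w ≠ u := h.uw.ne.symm
  have hvu : v ≠ u := h.vu.ne
  have hwv : w ≠ v := h.vw.symm
  have hu := h.hu
  have hv := h.hv
  have hw := h.hw
  have hdis := h.disj
  have hpq : p ≠ q := by rintro rfl; exact hqu hpu
  have hwnv : ∀ x ∈ X, x ∈ f w → x ∉ f v := fun x hx h1 h2 => hdis w hw hwu hwv x hx h2 h1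
  have hzv : z ∉ f v := hwnv z hz hzw
  have huv2 : u ∈ nb T S w := mem_nb.2 ⟨hu, h.uw.symm⟩
  -- a neighbour of `w` in the remaining part
  obtain ⟨c, hcS, hcu, hcv, hwc⟩ : ∃ c ∈ S, c ≠ u ∧ c ≠ v ∧ T.Adj w c := by
    by_contra hcon
    push Not at hcon
    have hwv' : ¬ T.Adj w v := fun hh => hwu (h.nv w hw hh.symm)
    have hw1 : ∀ b ∈ S, T.Adj w b → b = u := by
      intro b hb hwb
      by_contra hbu
      by_cases hbv : b = v
      · subst hbv; exact hwv' hwb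
      · exact hcon b hb hbu hbv hwb
    have := h.conn {v, u, w} (by grind) ⟨v, by simp⟩ (by
      intro a ha b hb hab
      simp only [Finset.mem_insert, Finset.mem_singleton] at ha ⊢
      rcases ha with rfl | rfl | rfl
      · right; left; exact h.nv b hb hab
      · rcases h.nu b hb hab with hh | hh <;> simp [hh]
      · right; left; exact hw1 b hb hab)
    have h4 := h.card
    rw [← this] at h4
    have := Finset.card_le_three (a := v) (b := u) (c := w)
    omega
  have hcw : c ≠ w := hwc.ne.symm
  have h2 : 2 ≤ (nb T S w).card := by
    have : ({u, c} : Finset V) ⊆ nb T S w := by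
      intro x hx
      simp only [Finset.mem_insert, Finset.mem_singleton] at hx
      rcases hx with rfl | rfl
      · exact huv2
      · exact mem_nb.2 ⟨hcS, hwc⟩
    have h2 := Finset.card_le_card this
    rwa [Finset.card_pair (Ne.symm hcu)] at h2
  by_cases h3 : 3 ≤ (nb T S w).card
  · -- degree at least three
    set D := (S.erase u).erase v with hD
    have mD : ∀ d, d ∈ D ↔ d ≠ v ∧ d ≠ u ∧ d ∈ S := by intro d; simp [hD]
    have hDS : D ⊆ S := fun d hd => ((mD d).1 hd).2.2
    have hwD : w ∈ D := (mD w).2 ⟨hwv, hwu, hw⟩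
    have hcardD : D.card + 2 = S.card := by
      have h1 := Finset.card_erase_add_one hu
      have h2 : D.card + 1 = (S.erase u).card :=
        Finset.card_erase_add_one (Finset.mem_erase.2 ⟨hvu, hv⟩)
      omega
    have hss : D ⊂ S := ⟨hDS, fun hh => ((mD u).1 (hh hu)).2.1 rfl⟩
    have hcl : ∀ a ∈ D, a ≠ w → ∀ b ∈ S, T.Adj a b → b ∈ D := by
      intro a ha haw b hb hab
      rw [mD] at ha ⊢
      refine ⟨?_, ?_, hb⟩
      · rintro rfl
        exact ha.2.1 (h.nv a ha.2.2 hab.symm)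
      · rintro rfl
        rcases h.nu a ha.2.2 hab.symm with hh | hh
        · exact ha.1 hh
        · exact haw hh
    have hnbD : nb T D w = (nb T S w).erase u := by
      ext b
      rw [Finset.mem_erase, mem_nb, mem_nb, mD]
      constructor
      · rintro ⟨⟨_, h1, h2⟩, h3⟩
        exact ⟨h1, h2, h3⟩
      · rintro ⟨h1, h2, h3⟩
        refine ⟨⟨?_, h1, h2⟩, h3⟩
        rintro rfl
        exact hwu (h.nv w hw h3.symm)
    have hnbcard : 2 ≤ (nb T D w).card := by
      rw [hnbD]
      have := Finset.card_erase_add_one huv2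
      omega
    have hconn : Conn T D := h.conn.prune hDS hwD hcl
    have hskel : Skel T D := h.skel.prune hDS hwD hcl h3 hnbcard
    have hD3 : 3 ≤ D.card := by
      have h1 : nb T D w ⊆ D.erase w := by
        intro b hb
        rw [mem_nb] at hb
        exact Finset.mem_erase.2 ⟨hb.2.ne.symm, hb.1⟩
      have h2 := Finset.card_le_card h1
      have h3 := Finset.card_erase_add_one hwD
      omega
    have inY : ∀ d ∈ D, d ≠ w → ∀ x ∈ X, x ∈ f d → x ∈ pts X f v u := by
      intro d hd hdw x hx hxd
      rw [mD] at hd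
      exact mem_pts.2 ⟨hx, fun hxv => hdis d hd.2.2 hd.2.1 hd.1 x hx hxv hxd,
        hall d hd.2.2 hd.2.1 hd.1 hdw x hx hxd⟩
    have hqD : ∀ d ∈ D, q ∉ f d := by
      intro d hd
      rw [mD] at hd
      exact hdis d hd.2.2 hd.2.1 hd.1 q hq hqv
    have hzD : ∀ d ∈ D, d ≠ w → z ∉ f d := by
      intro d hd hdw hzd
      rw [mD] at hd
      exact hzu (hall d hd.2.2 hd.2.1 hd.1 hdw z hz hzd)
    have hptsX : pts X f v u ⊆ X := fun x hx => (mem_pts.1 hx).1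
    -- it is enough to represent `D` on `pts` and one further point
    have key : ∀ o ∈ X, (∀ d ∈ D, d ≠ w → o ∉ f d) →
        (∀ d ∈ D, d ≠ w → T.Adj d w → Cross (insert o (pts X f v u)) (f d) (f w)) →
        S.card + 1 ≤ X.card := by
      intro o ho hoD hcr
      have hrep : Rep T D (insert o (pts X f v u)) f := by
        refine h.rep.restrict hDS (Finset.insert_subset ho hptsX) ?_
        intro a ha b hb hab
        by_cases haw : a = w
        · subst haw
          exact (hcr b hb hab.ne.symm hab.symm).symm
        by_cases hbw : b = w
        · subst hbw
          exact hcr a ha haw hab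
        obtain ⟨⟨x, hx, hxd, hxe⟩, ⟨x', hx', hxd', hxe'⟩, ⟨y, hy, hyd, hye⟩, _⟩ :=
          h.rep.cross (hDS ha) (hDS hb) hab
        exact ⟨⟨x, Finset.mem_insert_of_mem (inY a ha haw x hx hxd), hxd, hxe⟩,
          ⟨x', Finset.mem_insert_of_mem (inY a ha haw x' hx' hxd'), hxd', hxe'⟩,
          ⟨y, Finset.mem_insert_of_mem (inY b hb hbw y hy hye), hyd, hye⟩,
          ⟨o, Finset.mem_insert_self _ _, hoD a ha haw, hoD b hb hbw⟩⟩
      have h1 := IH D hss _ f hconn hskel hD3 hrep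
      have h2 := Finset.card_insert_le o (pts X f v u)
      have h4 : insert z (insert p (insert q (pts X f v u))) ⊆ X := by
        intro x hx
        simp only [Finset.mem_insert] at hx
        rcases hx with rfl | rfl | rfl | hx
        · exact hz
        · exact hp
        · exact hq
        · exact hptsX hx
      have h5 := Finset.card_le_card h4
      rw [Finset.card_insert_of_notMem, Finset.card_insert_of_notMem,
        Finset.card_insert_of_notMem] at h5
      · omega
      · simp [mem_pts, hqv]
      · simp [mem_pts, hpv, hpq]
      · simp only [Finset.mem_insert, mem_pts]
        rintro (rfl | rfl | hh)
        · exact hzu hpu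
        · exact hzv hqv
        · exact hzu hh.2.2
    by_cases hA : ∃ i ∈ D, i ≠ w ∧ T.Adj i w ∧ ∀ x ∈ pts X f v u, x ∈ f w → x ∈ f i
    · by_cases hB : ∃ j ∈ D, j ≠ w ∧ T.Adj j w ∧ ∀ x ∈ pts X f v u, x ∉ f w → x ∈ f j
      · exfalso
        -- some neighbour of `w` has all of `pts`
        have hfull : ∃ k ∈ D, k ≠ w ∧ T.Adj k w ∧ ∀ x ∈ pts X f v u, x ∈ f k := by
          obtain ⟨i, hi, hiw, hia, hi'⟩ := hA
          obtain ⟨j, hj, hjw, hja, hj'⟩ := hB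
          by_cases hij : i = j
          · subst hij
            exact ⟨i, hi, hiw, hia, fun x hx => by
              by_cases hxw : x ∈ f w
              · exact hi' x hx hxw
              · exact hj' x hx hxw⟩
          have hnadj : ¬ T.Adj i j := fun hh => hF.no_triangle hh hja hia
          have hnc : ¬ Cross X (f i) (f j) := fun hh =>
            hnadj ((h.rep i (hDS hi) j (hDS hj) hij).2 hh)
          obtain ⟨_, ⟨x, hx, hxi, hxw⟩, _⟩ := h.rep.cross (hDS hi) hw hia
          have hxj : x ∈ f j := hj' x (inY i hi hiw x hx hxi) hxw
          by_contra hcon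
          push Not at hcon
          obtain ⟨a, ha, hai⟩ := hcon i hi hiw hia
          obtain ⟨b, hb, hbj⟩ := hcon j hj hjw hja
          have haj : a ∈ f j := hj' a ha (fun hh => hai (hi' a ha hh))
          have hbi : b ∈ f i := hi' b hb (by_contra fun hh => hbj (hj' b hb hh))
          exact hnc ⟨⟨x, hx, hxi, hxj⟩, ⟨b, hptsX hb, hbi, hbj⟩, ⟨a, hptsX ha, hai, haj⟩,
            ⟨q, hq, hqD i hi, hqD j hj⟩⟩
        obtain ⟨k, hk, hkw, hka, hk'⟩ := hfull
        -- `k` has another neighbour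
        have : ∃ y ∈ S, T.Adj k y ∧ y ≠ w := by
          by_contra hcon
          push Not at hcon
          have h1 : nb T S k = {w} := by
            ext b
            rw [mem_nb, Finset.mem_singleton]
            constructor
            · rintro ⟨h1, h2⟩; exact hcon b h1 h2
            · rintro rfl; exact ⟨hw, hka⟩
          have := h.skel k (hDS hk) (by simp [h1]) w hw hka
          omega
        obtain ⟨y, hyS, hky, hyw⟩ := this
        have hyD := hcl k hk hkw y hyS hky
        obtain ⟨_, _, ⟨x, hx, hxk, hxy⟩, _⟩ := h.rep.cross (hDS hk) hyS hky
        exact hxk (hk' x (inY y hyD hyw x hx hxy))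
      · push Not at hB
        refine key z hz hzD ?_
        intro d hd hdw hadj
        obtain ⟨x, hx, hxw, hxd⟩ := hB d hd hdw hadj
        obtain ⟨⟨a, ha, had, haw⟩, ⟨b, hb, hbd, hbw⟩, _⟩ := h.rep.cross (hDS hd) hw hadj
        exact ⟨⟨a, Finset.mem_insert_of_mem (inY d hd hdw a ha had), had, haw⟩,
          ⟨b, Finset.mem_insert_of_mem (inY d hd hdw b hb hbd), hbd, hbw⟩,
          ⟨z, Finset.mem_insert_self _ _, hzD d hd hdw, hzw⟩,
          ⟨x, Finset.mem_insert_of_mem hx, hxd, hxw⟩⟩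
    · push Not at hA
      refine key q hq (fun d hd _ => hqD d hd) ?_
      intro d hd hdw hadj
      obtain ⟨x, hx, hxw, hxd⟩ := hA d hd hdw hadj
      obtain ⟨⟨a, ha, had, haw⟩, ⟨b, hb, hbd, hbw⟩, _⟩ := h.rep.cross (hDS hd) hw hadj
      exact ⟨⟨a, Finset.mem_insert_of_mem (inY d hd hdw a ha had), had, haw⟩,
        ⟨b, Finset.mem_insert_of_mem (inY d hd hdw b hb hbd), hbd, hbw⟩,
        ⟨x, Finset.mem_insert_of_mem hx, hxd, hxw⟩,
        ⟨q, Finset.mem_insert_self _ _, hqD d hd, hqD w hwD⟩⟩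
  · -- degree two
    have hw2 : (nb T S w).card = 2 := by omega
    set S' := S.erase v with hS'
    set X' := X.erase p with hX'
    have hS'S : S' ⊆ S := Finset.erase_subset _ _
    have hss : S' ⊂ S := Finset.erase_ssubset hv
    have hcardS : S'.card + 1 = S.card := Finset.card_erase_add_one hv
    have hcardX : X'.card + 1 = X.card := Finset.card_erase_add_one hp
    have huS' : u ∈ S' := Finset.mem_erase.2 ⟨hvu.symm, hu⟩
    have hcl : ∀ a ∈ S', a ≠ u → ∀ b ∈ S, T.Adj a b → b ∈ S' := by
      intro a ha hau b hb hab
      refine Finset.mem_erase.2 ⟨?_, hb⟩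
      rintro rfl
      exact hau (h.nv a (hS'S ha) hab.symm)
    have hconn : Conn T S' := h.conn.prune hS'S huS' hcl
    have hskel : Skel T S' := by
      intro x hx hx1 y hy hxy
      by_cases hxu : x = u
      · subst hxu
        have hyw : y = w := (h.nu y (hS'S hy) hxy).resolve_left (Finset.mem_erase.1 hy).1
        subst hyw
        rw [nb_prune hS'S hcl hy hwu]
        exact hw2
      rw [nb_prune hS'S hcl hx hxu] at hx1
      by_cases hyu : y = u
      · subst hyu
        have hxw : x = w :=
          (h.nu x (hS'S hx) hxy.symm).resolve_left (Finset.mem_erase.1 hx).1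
        subst hxw
        omega
      rw [nb_prune hS'S hcl hy hyu]
      exact h.skel x (hS'S hx) hx1 y (hS'S hy) hxy
    have nvX : ∀ x ∈ X, x ∉ f v → x ∈ X' := by
      intro x hx hxv
      refine Finset.mem_erase.2 ⟨?_, hx⟩
      rintro rfl
      exact hxv hpv
    have hqX : q ∈ X' := Finset.mem_erase.2 ⟨hpq.symm, hq⟩
    have dnv : ∀ d ∈ S', d ≠ u → ∀ x ∈ X, x ∈ f d → x ∈ X' := by
      intro d hd hdu x hx hxd
      exact nvX x hx fun hxv => hdis d (hS'S hd) hdu (Finset.mem_erase.1 hd).1 x hx hxv hxd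
    have hqd : ∀ d ∈ S', d ≠ u → q ∉ f d := by
      intro d hd hdu
      exact hdis d (hS'S hd) hdu (Finset.mem_erase.1 hd).1 q hq hqv
    have hwS' : w ∈ S' := Finset.mem_erase.2 ⟨hwv, hw⟩
    have hcS' : c ∈ S' := Finset.mem_erase.2 ⟨hcv, hcS⟩
    have c1 : Cross X' (f u) (f w) := by
      obtain ⟨_, _, ⟨x, hx, hxw, hxc⟩, _⟩ := h.rep.cross hw hcS hwc
      exact ⟨⟨t, dnv w hwS' hwu t ht htw, htu, htw⟩,
        ⟨x, dnv c hcS' hcu x hx hxc, hall c hcS hcu hcv hcw x hx hxc, hxw⟩,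
        ⟨z, dnv w hwS' hwu z hz hzw, hzu, hzw⟩, ⟨q, hqX, hqu, hqd w hwS' hwu⟩⟩
    have hrep : Rep T S' X' f := by
      refine h.rep.restrict hS'S (Finset.erase_subset _ _) ?_
      intro a ha b hb hab
      by_cases hau : a = u
      · subst hau
        rw [(h.nu b (hS'S hb) hab).resolve_left (Finset.mem_erase.1 hb).1]
        exact c1
      by_cases hbu : b = u
      · subst hbu
        rw [(h.nu a (hS'S ha) hab.symm).resolve_left (Finset.mem_erase.1 ha).1]
        exact c1.symm
      obtain ⟨⟨x, hx, hxd, hxe⟩, ⟨x', hx', hxd', hxe'⟩, ⟨y, hy, hyd, hye⟩, _⟩ :=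
        h.rep.cross (hS'S ha) (hS'S hb) hab
      exact ⟨⟨x, dnv a ha hau x hx hxd, hxd, hxe⟩, ⟨x', dnv a ha hau x' hx' hxd', hxd', hxe'⟩,
        ⟨y, dnv b hb hbu y hy hye, hyd, hye⟩, ⟨q, hqX, hqd a ha hau, hqd b hb hbu⟩⟩
    have h4 := h.card
    have := IH S' hss X' f hconn hskel (by omega) hrep
    omega

theorem Config.main {T : SimpleGraph V} {S : Finset V} {X : Finset α} {f : V → Set α}
    {v u w : V} (h : Config T S X f v u w) (hF : Forest T) (IH : ∀ S' ⊂ S, Goal T α S') :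
    S.card + 1 ≤ X.card := by
  have hwu : w ≠ u := h.uw.ne.symm
  have hvu : v ≠ u := h.vu.ne
  have hwv : w ≠ v := h.vw.symm
  set g := Function.update f u (f u)ᶜ with hg
  have hgu : g u = (f u)ᶜ := by simp [hg]
  have hgd : ∀ d, d ≠ u → g d = f d := by
    intro d hd; simp [hg, Function.update_of_ne hd]
  have h' : Config T S X g v u w := h.compl
  by_cases hA : ∃ b ∈ S, b ≠ u ∧ b ≠ v ∧ b ≠ w ∧ ∃ x ∈ X, x ∈ f b ∧ x ∉ f u
  swap
  · push Not at hA
    exact h.oneside hF IH hA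
  by_cases hB : ∃ a ∈ S, a ≠ u ∧ a ≠ v ∧ a ≠ w ∧ ∃ x ∈ X, x ∈ f a ∧ x ∈ f u
  swap
  · push Not at hB
    refine h'.oneside hF IH ?_
    intro d hd hdu hdv hdw x hx hxd
    rw [hgd d hdu] at hxd
    rw [hgu]
    exact hB d hd hdu hdv hdw x hx hxd
  obtain ⟨b, hbS, hbu, hbv, hbw, y, hy, hyb, hyu⟩ := hA
  obtain ⟨a, haS, hau, hav, haw, x, hx, hxa, hxu⟩ := hB
  have ha1 : ∀ x ∈ X, x ∈ f a → x ∈ f u :=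
    (h.dich haS hau hav haw).resolve_right fun hh => hh x hx hxa hxu
  have hb1 : ∀ x ∈ X, x ∈ f b → x ∉ f u :=
    (h.dich hbS hbu hbv hbw).resolve_left fun hh => hyu (hh y hy hyb)
  have haD : a ∈ side S X f v u w := mem_side.2 ⟨haS, hau, hav, Or.inr ha1⟩
  have hbD : b ∉ side S X f v u w := by
    rw [mem_side]
    rintro ⟨_, _, _, hh | hh⟩
    · exact hbw hh
    · exact hyu (hh y hy hyb)
  have hbD' : b ∈ side S X g v u w := by
    refine mem_side.2 ⟨hbS, hbu, hbv, Or.inr ?_⟩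
    rw [hgd b hbu, hgu]
    exact hb1
  have haD' : a ∉ side S X g v u w := by
    rw [mem_side, hgd a hau, hgu]
    rintro ⟨_, _, _, hh | hh⟩
    · exact haw hh
    · exact hh x hx hxa hxu
  obtain ⟨c, hc, hcw, hwc⟩ := h.side_nb haD haw
  obtain ⟨e, he, hew, hwe⟩ := h'.side_nb hbD' hbw
  rw [mem_side] at hc he
  have hce : c ≠ e := by
    rintro rfl
    obtain ⟨_, _, ⟨x, hx, _, hxc⟩, _⟩ := h.rep.cross h.hw hc.1 hwc
    have h1 := (hc.2.2.2.resolve_left hcw) x hx hxc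
    have h2 := (he.2.2.2.resolve_left hew) x hx (by rw [hgd c hc.2.1]; exact hxc)
    rw [hgu] at h2
    exact h2 h1
  have h3 : 3 ≤ (nb T S w).card := by
    have : ({u, c, e} : Finset V) ⊆ nb T S w := by
      intro x hx
      simp only [Finset.mem_insert, Finset.mem_singleton] at hx
      rcases hx with rfl | rfl | rfl
      · exact mem_nb.2 ⟨h.hu, h.uw.symm⟩
      · exact mem_nb.2 ⟨hc.1, hwc⟩
      · exact mem_nb.2 ⟨he.1, hwe⟩
    have h2 := Finset.card_le_card this
    rwa [Finset.card_eq_three.2 ⟨u, c, e, hc.2.1.symm, he.2.1.symm, hce, rfl⟩] at h2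
  have k1 := h.side_card IH h3 haD haw hbS hbu hbv hbD
  have k2 := h'.side_card IH h3 hbD' hbw haS hau hav haD'
  -- counting vertices
  have hun : (S.erase u).erase v ⊆ side S X f v u w ∪ side S X g v u w := by
    intro d hd
    simp only [Finset.mem_erase] at hd
    rw [Finset.mem_union, mem_side, mem_side, hgd d hd.2.1, hgu]
    by_cases hdw : d = w
    · left; exact ⟨hd.2.2, hd.2.1, hd.1, Or.inl hdw⟩
    rcases h.dich hd.2.2 hd.2.1 hd.1 hdw with hh | hh
    · left; exact ⟨hd.2.2, hd.2.1, hd.1, Or.inr hh⟩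
    · right; exact ⟨hd.2.2, hd.2.1, hd.1, Or.inr hh⟩
  have hin : 0 < (side S X f v u w ∩ side S X g v u w).card := by
    refine Finset.card_pos.2 ⟨w, ?_⟩
    rw [Finset.mem_inter, mem_side, mem_side]
    exact ⟨⟨h.hw, hwu, hwv, Or.inl rfl⟩, ⟨h.hw, hwu, hwv, Or.inl rfl⟩⟩
  have hcs := Finset.card_union_add_card_inter (side S X f v u w) (side S X g v u w)
  have hle := Finset.card_le_card hun
  have e1 := Finset.card_erase_add_one h.hu
  have e2 : ((S.erase u).erase v).card + 1 = (S.erase u).card :=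
    Finset.card_erase_add_one (Finset.mem_erase.2 ⟨hvu, h.hv⟩)
  -- counting points
  obtain ⟨⟨p, hp, hpv, hpu⟩, ⟨q, hq, hqv, hqu⟩, _⟩ := h.rep.cross h.hv h.hu h.vu
  have hpq : p ≠ q := by rintro rfl; exact hqu hpu
  have hdisj : Disjoint (pts X f v u) (pts X g v u) := by
    rw [Finset.disjoint_left]
    intro x hx hx'
    rw [mem_pts] at hx hx'
    rw [hgu] at hx'
    exact hx'.2.2 hx.2.2
  have hsub : insert p (insert q (pts X f v u ∪ pts X g v u)) ⊆ X := by
    intro x hx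
    simp only [Finset.mem_insert, Finset.mem_union, mem_pts] at hx
    rcases hx with rfl | rfl | hx | hx
    · exact hp
    · exact hq
    · exact hx.1
    · exact hx.1
  have hX := Finset.card_le_card hsub
  rw [Finset.card_insert_of_notMem, Finset.card_insert_of_notMem,
    Finset.card_union_of_disjoint hdisj] at hX
  · omega
  · simp [mem_pts, hgd v hvu, hqv]
  · simp [mem_pts, hgd v hvu, hpv, hpq]

theorem Cross.four {X : Finset α} {f g : Set α} (h : Cross X f g) : 4 ≤ X.card := by
  obtain ⟨⟨a, ha, ha1, ha2⟩, ⟨b, hb, hb1, hb2⟩, ⟨c, hc, hc1, hc2⟩, ⟨d, hd, hd1, hd2⟩⟩ := h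
  have : ({a, b, c, d} : Finset α) ⊆ X := by
    intro x hx
    simp only [Finset.mem_insert, Finset.mem_singleton] at hx
    rcases hx with rfl | rfl | rfl | rfl <;> assumption
  have h2 := Finset.card_le_card this
  have h1 : ({a, b, c, d} : Finset α).card = 4 := by
    rw [Finset.card_insert_of_notMem, Finset.card_insert_of_notMem, Finset.card_pair]
    · rintro rfl; contradiction
    · simp only [Finset.mem_insert, Finset.mem_singleton]
      rintro (rfl | rfl) <;> contradiction
    · simp only [Finset.mem_insert, Finset.mem_singleton]
      rintro (rfl | rfl | rfl) <;> contradiction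
  omega

theorem goal_all {T : SimpleGraph V} (hF : Forest T) (S : Finset V) : Goal T α S := by
  induction S using Finset.strongInduction with
  | H S IH =>
  intro X f hconn hskel h3 hrep
  obtain ⟨v, hv, hvn⟩ := hF S (Finset.card_pos.1 (by omega))
  obtain ⟨u, hu, hvu⟩ := hconn.exists_nb (by omega) hv
  have huv' : v ≠ u := hvu.ne
  have hnv : ∀ b ∈ S, T.Adj v b → b = u := by
    intro b hb hvb
    exact Finset.card_le_one.1 hvn b (mem_nb.2 ⟨hb, hvb⟩) u (mem_nb.2 ⟨hu, hvu⟩)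
  have hvn1 : (nb T S v).card = 1 :=
    le_antisymm hvn (Finset.card_pos.2 ⟨u, mem_nb.2 ⟨hu, hvu⟩⟩)
  have hu2 := hskel v hv hvn1 u hu hvu
  have h4 := (hrep.cross hv hu hvu).four
  by_cases hS : S.card = 3
  · omega
  obtain ⟨w, hw, hwv⟩ : ∃ w ∈ nb T S u, w ≠ v := Finset.exists_mem_ne (by omega) v
  rw [mem_nb] at hw
  have hnu : ∀ b ∈ S, T.Adj u b → b = v ∨ b = w := by
    intro b hb hub
    by_contra hcon
    push Not at hcon
    have : ({v, w, b} : Finset V) ⊆ nb T S u := by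
      intro x hx
      simp only [Finset.mem_insert, Finset.mem_singleton] at hx
      rcases hx with rfl | rfl | rfl
      · exact mem_nb.2 ⟨hv, hvu.symm⟩
      · exact mem_nb.2 hw
      · exact mem_nb.2 ⟨hb, hub⟩
    have h2 := Finset.card_le_card this
    rw [Finset.card_eq_three.2 ⟨v, w, b, hwv.symm, hcon.1.symm, hcon.2.symm, rfl⟩] at h2
    omega
  have hwu : w ≠ u := hw.2.ne.symm
  set D := (S.erase u).erase v with hD
  have mD : ∀ d, d ∈ D ↔ d ≠ v ∧ d ≠ u ∧ d ∈ S := by intro d; simp [hD]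
  have hDconn : Conn T D := by
    refine hconn.prune (w := w) (fun d hd => ((mD d).1 hd).2.2) ((mD w).2 ⟨hwv, hwu, hw.1⟩) ?_
    intro a ha haw b hb hab
    rw [mD] at ha ⊢
    refine ⟨?_, ?_, hb⟩
    · rintro rfl
      exact ha.2.1 (hnv a ha.2.2 hab.symm)
    · rintro rfl
      rcases hnu a ha.2.2 hab.symm with hh | hh
      · exact ha.1 hh
      · exact haw hh
  -- once one side of `v` is split by no set of `D`, we can normalise
  have fin : ∀ f : V → Set α, Rep T S X f →
      (∀ d ∈ D, (∀ x ∈ X, x ∈ f v → x ∉ f d) ∨ (∀ x ∈ X, x ∈ f v → x ∈ f d)) →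
      S.card + 1 ≤ X.card := by
    intro f hrep hgood
    let g : V → Set α := fun d =>
      if d ∈ D ∧ ¬ (∀ x ∈ X, x ∈ f v → x ∉ f d) then (f d)ᶜ else f d
    have hgv : g v = f v := by
      have : v ∉ D := by simp [hD]
      simp [g, this]
    have hc : Config T S X g v u w := by
      refine ⟨hconn, hskel, hrep.compl ?_, by omega, hv, hu, hw.1, hvu, hw.2, hwv.symm,
        hnv, hnu, ?_⟩
      · intro a
        by_cases hh : a ∈ D ∧ ¬ (∀ x ∈ X, x ∈ f v → x ∉ f a)
        · right; simp only [g, if_pos hh]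
        · left; simp only [g, if_neg hh]
      · intro d hd hdu hdv x hx hxv
        rw [hgv] at hxv
        have hdD : d ∈ D := (mD d).2 ⟨hdv, hdu, hd⟩
        by_cases hh : ∀ x ∈ X, x ∈ f v → x ∉ f d
        · simp only [g, hdD, true_and, if_neg (not_not.2 hh)]
          exact hh x hx hxv
        · simp only [g, hdD, true_and, if_pos hh]
          have := ((hgood d hdD).resolve_left hh) x hx hxv
          simpa using this
    exact hc.main hF IH
  have hnc : ∀ d ∈ D, ¬ Cross X (f v) (f d) := by
    intro d hd hh
    rw [mD] at hd
    exact hd.2.1 (hnv d hd.2.2 ((hrep v hv d hd.2.2 hd.1.symm).2 hh))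
  let A := D.filter (fun d => (∀ x ∈ X, x ∈ f v → x ∉ f d) ∨ (∀ x ∈ X, x ∈ f v → x ∈ f d))
  have hbad : ∀ d ∈ D, d ∉ A → (∀ x ∈ X, x ∉ f v → x ∉ f d) ∨ (∀ x ∈ X, x ∉ f v → x ∈ f d) := by
    intro d hd hdA
    by_contra hcon
    simp only [A, Finset.mem_filter, hd, true_and] at hdA
    push Not at hcon hdA
    obtain ⟨⟨x1, h1⟩, x2, h2⟩ := hcon
    obtain ⟨⟨x3, h3⟩, x4, h4⟩ := hdA
    exact hnc d hd ⟨⟨x3, h3⟩, ⟨x4, h4⟩, ⟨x1, h1⟩, ⟨x2, h2⟩⟩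
  by_cases hne : A.Nonempty
  · have hAD : A = D := by
      refine hDconn A (Finset.filter_subset _ _) hne ?_
      intro a ha b hb hab
      by_contra hbA
      have h2 := hbad b hb hbA
      have ha' := Finset.mem_filter.1 ha
      obtain ⟨⟨x1, h1, h1a, h1b⟩, ⟨x2, h2', h2a, h2b⟩, ⟨x3, h3', h3a, h3b⟩, ⟨x4, h4', h4a, h4b⟩⟩ :=
        hrep.cross ((mD a).1 ha'.1).2.2 ((mD b).1 hb).2.2 hab
      rcases ha'.2 with k | k <;> rcases h2 with l | l
      · exact l x1 h1 (fun hh => k x1 h1 hh h1a) h1b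
      · exact h2b (l x2 h2' (fun hh => k x2 h2' hh h2a))
      · exact l x3 h3' (fun hh => h3a (k x3 h3' hh)) h3b
      · exact h4b (l x4 h4' (fun hh => h4a (k x4 h4' hh)))
    refine fin f hrep ?_
    intro d hd
    rw [← hAD] at hd
    exact (Finset.mem_filter.1 hd).2
  · refine fin (Function.update f v (f v)ᶜ) (hrep.compl ?_) ?_
    · intro a
      by_cases ha : a = v
      · subst ha; simp
      · simp [Function.update_of_ne ha]
    · intro d hd
      have hdv : d ≠ v := ((mD d).1 hd).1
      rw [Function.update_of_ne hdv, Function.update_self]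
      exact hbad d hd (fun hh => hne ⟨d, hh⟩)

theorem forest_of_acyclic [Fintype V] {T : SimpleGraph V} (hT : T.IsAcyclic) : Forest T := by
  intro S hS
  -- longest path inside `S`
  let P : ℕ → Prop := fun n => ∃ (a b : V) (p : T.Walk a b), p.IsPath ∧ (∀ x ∈ p.support, x ∈ S) ∧
    p.length = n
  have hbd : ∀ n, P n → n ≤ Fintype.card V := by
    rintro n ⟨a, b, p, hp, _, rfl⟩
    exact hp.length_lt.le
  obtain ⟨s, hs⟩ := hS
  have h0 : P 0 := ⟨s, s, SimpleGraph.Walk.nil, by simp, by simpa using hs, rfl⟩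
  have hP := Nat.findGreatest_spec (Nat.zero_le (Fintype.card V)) h0
  obtain ⟨a, b, p, hp, hpS, hlen⟩ := hP
  refine ⟨a, hpS a (by simp), ?_⟩
  have : nb T S a ⊆ {p.snd} := by
    intro c hc
    rw [mem_nb] at hc
    rw [Finset.mem_singleton]
    by_cases hcp : c ∈ p.support
    · exact hT.eq_snd_of_adj_start hp hc.2 hcp
    · exfalso
      have hP' : P (p.length + 1) := by
        refine ⟨c, b, SimpleGraph.Walk.cons hc.2.symm p, ?_, ?_, by simp⟩
        · rw [SimpleGraph.Walk.cons_isPath_iff]; exact ⟨hp, hcp⟩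
        · intro x hx
          rw [SimpleGraph.Walk.support_cons, List.mem_cons] at hx
          rcases hx with rfl | hx
          · exact hc.1
          · exact hpS x hx
      have := Nat.le_findGreatest (hbd _ hP') hP'
      omega
  simpa using Finset.card_le_card this

theorem conn_univ [Fintype V] {T : SimpleGraph V} (hT : T.Connected) : Conn T Finset.univ := by
  rintro A - ⟨a, ha⟩ hc
  ext b
  simp only [Finset.mem_univ, iff_true]
  obtain ⟨p⟩ := hT.preconnected a b
  induction p with
  | nil => exact ha
  | cons hadj p ih => exact ih (hc _ ha _ (Finset.mem_univ _) hadj)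

theorem nb_univ [Fintype V] (T : SimpleGraph V) (v : V) :
    (T.neighborSet v).ncard = (nb T Finset.univ v).card := by
  rw [← Set.ncard_coe_finset]
  congr 1
  ext b
  simp [nb]

theorem lower [Fintype V] (T : SimpleGraph V) (hT : T.IsTree)
    (hskel : ∀ x : V, (T.neighborSet x).ncard = 1 →
      ∀ y : V, T.Adj x y → (T.neighborSet y).ncard = 2)
    (hn : 3 ≤ Fintype.card V) (f : V → Finset ℕ) (hf : IsOverlapRep T f) :
    Fintype.card V ≤ repSize f := by
  have hF := forest_of_acyclic hT.isAcyclic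
  let U : Finset ℕ := Finset.univ.biUnion f
  have hU : repSize f = U.card := by
    unfold repSize
    rw [← Set.ncard_coe_finset]
    congr 1
    ext x
    simp [U]
  let g : V → Set (Option ℕ) := fun v => {o | ∃ x ∈ f v, o = some x}
  have hg : ∀ v x, some x ∈ g v ↔ x ∈ f v := by intro v x; simp [g]
  have hgn : ∀ v, none ∉ g v := by intro v; simp [g]
  have hrep : Rep T Finset.univ (Finset.insertNone U) g := by
    intro a _ b _ hab
    rw [hf a b hab]
    constructor
    · rintro ⟨⟨x, hx⟩, h1, h2⟩
      rw [Finset.not_subset] at h1 h2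
      obtain ⟨y, hy, hy'⟩ := h1
      obtain ⟨z, hz, hz'⟩ := h2
      rw [Finset.mem_inter] at hx
      have hin : ∀ v, ∀ x ∈ f v, some x ∈ Finset.insertNone U := by
        intro v x hx
        rw [Finset.some_mem_insertNone]
        exact Finset.mem_biUnion.2 ⟨v, Finset.mem_univ _, hx⟩
      exact ⟨⟨some x, hin a x hx.1, (hg _ _).2 hx.1, (hg _ _).2 hx.2⟩,
        ⟨some y, hin a y hy, (hg _ _).2 hy, fun hh => hy' ((hg _ _).1 hh)⟩,
        ⟨some z, hin b z hz, fun hh => hz' ((hg _ _).1 hh), (hg _ _).2 hz⟩,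
        ⟨none, Finset.none_mem_insertNone, hgn a, hgn b⟩⟩
    · rintro ⟨⟨x, _, hxa, hxb⟩, ⟨y, _, hya, hyb⟩, ⟨z, _, hza, hzb⟩, _⟩
      obtain ⟨x', hx', rfl⟩ := hxa
      obtain ⟨y', hy', rfl⟩ := hya
      obtain ⟨z', hz', rfl⟩ := hzb
      rw [hg] at hxb hyb hza
      exact ⟨⟨x', Finset.mem_inter.2 ⟨hx', hxb⟩⟩, fun hh => hyb (hh hy'), fun hh => hza (hh hz')⟩
  have := goal_all (α := Option ℕ) hF Finset.univ (Finset.insertNone U) g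
    (conn_univ hT.connected) (by
      intro x _ hx y _ hxy
      rw [← nb_univ] at hx ⊢
      exact hskel x hx y hxy) (by simpa using hn) hrep
  rw [Finset.card_insertNone, Finset.card_univ] at this
  omega

/-- Every finite graph has an overlap representation. -/
theorem exists_rep [Fintype V] (T : SimpleGraph V) : ∃ f : V → Finset ℕ, IsOverlapRep T f := by
  obtain ⟨e, he⟩ : ∃ e : Sym2 (Fin (Fintype.card V)) → ℕ, Function.Injective e :=
    Countable.exists_injective_nat _
  let i := Fintype.equivFin V
  let E : V → V → ℕ := fun a b => e s(i a, i b)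
  have hE : ∀ a b c d, E a b = E c d → (a = c ∧ b = d) ∨ (a = d ∧ b = c) := by
    intro a b c d h
    have := he h
    simpa using this
  have hEs : ∀ a b, E a b = E b a := by
    intro a b
    simp only [E, Sym2.eq_swap]
  let f : V → Finset ℕ := fun v => (Finset.univ.filter (fun b => b = v ∨ T.Adj v b)).image (E v)
  have mf : ∀ v x, x ∈ f v ↔ ∃ b, (b = v ∨ T.Adj v b) ∧ E v b = x := by
    intro v x; simp [f]
  have hself : ∀ a b, a ≠ b → ¬ f a ⊆ f b := by
    intro a b hab hsub
    have h1 := hsub ((mf a (E a a)).2 ⟨a, Or.inl rfl, rfl⟩)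
    obtain ⟨c, _, hc⟩ := (mf _ _).1 h1
    rcases hE _ _ _ _ hc with h | h
    · exact hab h.1.symm
    · exact hab h.1.symm
  refine ⟨f, ?_⟩
  intro a b hab
  constructor
  · intro hadj
    refine ⟨⟨E a b, ?_⟩, hself a b hab, hself b a hab.symm⟩
    rw [Finset.mem_inter, mf, mf]
    exact ⟨⟨b, Or.inr hadj, rfl⟩, ⟨a, Or.inr hadj.symm, hEs b a⟩⟩
  · rintro ⟨⟨x, hx⟩, -⟩
    rw [Finset.mem_inter, mf, mf] at hx
    obtain ⟨⟨c, hc, rfl⟩, d, hd, hx⟩ := hx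
    rcases hE _ _ _ _ hx with h | h
    · exact absurd h.1.symm hab
    · rcases hc with rfl | hc
      · exact absurd h.1.symm hab
      · rw [h.1]; exact hc

end SkelOverlap

theorem stmt_6 {V : Type*} [Fintype V] (T : SimpleGraph V) (hT : T.IsTree)
    (hskel : ∀ x : V, (T.neighborSet x).ncard = 1 →
      ∀ y : V, T.Adj x y → (T.neighborSet y).ncard = 2)
    (hn : 3 ≤ Fintype.card V) :
    (∀ f : V → Finset ℕ, IsOverlapRep T f → Fintype.card V ≤ repSize f) ∧
    Fintype.card V ≤ overlapNumber T := by
  have h1 := SkelOverlap.lower T hT hskel hn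
  refine ⟨h1, ?_⟩
  obtain ⟨f0, hf0⟩ := SkelOverlap.exists_rep T
  unfold overlapNumber
  refine le_csInf ⟨repSize f0, f0, hf0, rfl⟩ ?_
  rintro n ⟨f, hf, rfl⟩
  exact h1 f hf
end

section
/- Let G be an n-vertex graph with minimum degree at least 2 that is not the n-book B_n (in particular not K_3). Then G has an overlap representation of size |E(G)| − 1; hence φ(G) ≤ |E(G)| − 1. -/
def book (n : ℕ) : SimpleGraph (Fin n) :=
  SimpleGraph.fromRel (fun u v => (u : ℕ) < 2 ∨ (v : ℕ) < 2)

lemma exists_other {V : Type*} [Fintype V] (G : SimpleGraph V)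
    (hδ : ∀ v : V, 2 ≤ (G.neighborSet v).ncard) (b c : V) : ∃ d, d ≠ c ∧ G.Adj b d := by
  obtain ⟨d, hd, hne⟩ := Set.exists_ne_of_one_lt_ncard (s := G.neighborSet b)
    (by have := hδ b; omega) c
  exact ⟨d, hne, hd⟩

/-- A graph of minimum degree two all of whose edges meet an adjacent pair is a book. -/
lemma book_of_cover {V : Type*} [Fintype V] (G : SimpleGraph V)
    (hδ : ∀ v : V, 2 ≤ (G.neighborSet v).ncard) (x v : V) (hxv : G.Adj x v)
    (hcov : ∀ a b, G.Adj a b → a = x ∨ a = v ∨ b = x ∨ b = v) :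
    Nonempty (G ≃g book (Fintype.card V)) := by
  classical
  have hne : x ≠ v := hxv.ne
  have hadj : ∀ b, b ≠ x → b ≠ v → G.Adj b x ∧ G.Adj b v := by
    intro b hbx hbv
    obtain ⟨d, hd, hbd⟩ := exists_other G hδ b v
    obtain ⟨d', hd', hbd'⟩ := exists_other G hδ b x
    have h1 := hcov _ _ hbd
    have h2 := hcov _ _ hbd'
    grind
  have hcard : 2 ≤ Fintype.card V := by
    have : Finset.card ({x, v} : Finset V) ≤ _ := Finset.card_le_univ _
    rwa [Finset.card_pair hne] at this
  obtain ⟨e, he0, he1⟩ : ∃ e : V ≃ Fin (Fintype.card V),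
      e x = ⟨0, by omega⟩ ∧ e v = ⟨1, by omega⟩ := by
    let e0 := Fintype.equivFin V
    let e1 := e0.trans (Equiv.swap (e0 x) ⟨0, by omega⟩)
    have h1 : e1 x = ⟨0, by omega⟩ := by simp [e1]
    refine ⟨e1.trans (Equiv.swap (e1 v) ⟨1, by omega⟩), ?_, by simp⟩
    rw [Equiv.trans_apply, Equiv.swap_apply_of_ne_of_ne, h1]
    · exact fun h => hne (e1.injective h)
    · rw [h1]; simp
  have hlt : ∀ a, ((e a : ℕ) < 2 ↔ a = x ∨ a = v) := by
    intro a
    rw [← e.injective.eq_iff, ← e.injective.eq_iff (a := a) (b := v), he0, he1, Fin.ext_iff,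
      Fin.ext_iff]
    simp only
    omega
  refine ⟨⟨e, ?_⟩⟩
  intro a b
  simp only [book, SimpleGraph.fromRel_adj, hlt, ne_eq, e.injective.eq_iff]
  constructor
  · rintro ⟨hab, h⟩
    have h1 := hadj a
    have h2 := hadj b
    have := G.adj_comm a b
    have := G.adj_comm x v
    grind
  · intro h
    exact ⟨h.ne, by have := hcov _ _ h; tauto⟩

lemma exists_avoid {V : Type*} [Fintype V] (G : SimpleGraph V)
    (hδ : ∀ v : V, 2 ≤ (G.neighborSet v).ncard)
    (hnotbook : ¬ Nonempty (G ≃g book (Fintype.card V))) (x v : V) (hxv : G.Adj x v) :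
    ∃ e ∈ G.edgeSet, x ∉ e ∧ v ∉ e := by
  by_contra! hcon
  refine hnotbook (book_of_cover G hδ x v hxv ?_)
  intro a b hab
  have := hcon s(a, b) hab
  simp only [Sym2.mem_iff] at this
  grind

/-- The overlap relation on sets. -/
def Ov {α : Type*} (s t : Set α) : Prop := (s ∩ t).Nonempty ∧ ¬ s ⊆ t ∧ ¬ t ⊆ s

lemma Ov.symm_iff {α : Type*} (s t : Set α) : Ov s t ↔ Ov t s := by
  unfold Ov
  rw [Set.inter_comm]
  tauto

/-- The representation: complements of stars at `x` and `y`, stars elsewhere. -/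
def rep {V : Type*} (G : SimpleGraph V) (x y v : V) : Set (Sym2 V) :=
  {e | e ∈ G.edgeSet ∧ (v ∈ e ↔ ¬ (v = x ∨ v = y))}

lemma rep_end {V : Type*} [Fintype V] (G : SimpleGraph V)
    (hδ : ∀ v : V, 2 ≤ (G.neighborSet v).ncard)
    (hnotbook : ¬ Nonempty (G ≃g book (Fintype.card V))) (x y u v : V)
    (hu : u = x ∨ u = y) (hv : ¬ (v = x ∨ v = y)) :
    G.Adj u v ↔ Ov (rep G x y u) (rep G x y v) := by
  have huv : u ≠ v := by rintro rfl; exact hv hu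
  constructor
  · intro h
    refine ⟨?_, ?_, ?_⟩
    · obtain ⟨d, hd, hvd⟩ := exists_other G hδ v u
      refine ⟨s(v, d), ⟨hvd, ?_⟩, ⟨hvd, ?_⟩⟩
      · simp [hu, huv, hd.symm]
      · simp [hv]
    · obtain ⟨e, he, h1, h2⟩ := exists_avoid G hδ hnotbook u v h
      intro hs
      have := (hs (a := e) ⟨he, by tauto⟩).2
      tauto
    · intro hs
      have := (hs (a := s(u, v)) ⟨h, by simp [hv]⟩).2
      simp [hu] at this
  · rintro ⟨-, -, h⟩
    by_contra hna
    apply h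
    rintro e ⟨he, hve⟩
    refine ⟨he, ?_⟩
    have hve' : v ∈ e := by tauto
    have : u ∉ e := by
      intro hue
      have : e = s(u, v) := (Sym2.mem_and_mem_iff huv).1 ⟨hue, hve'⟩
      subst this
      exact hna he
    tauto

lemma rep_ov {V : Type*} [Fintype V] (G : SimpleGraph V)
    (hδ : ∀ v : V, 2 ≤ (G.neighborSet v).ncard)
    (hnotbook : ¬ Nonempty (G ≃g book (Fintype.card V))) (x y u v : V)
    (hxy : G.Adj x y) (huv : u ≠ v) :
    G.Adj u v ↔ Ov (rep G x y u) (rep G x y v) := by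
  by_cases hu : u = x ∨ u = y
  · by_cases hv : v = x ∨ v = y
    · have hadj : G.Adj u v := by
        have := hxy.symm
        grind
      refine ⟨fun _ => ⟨?_, ?_, ?_⟩, fun _ => hadj⟩
      · obtain ⟨e, he, h1, h2⟩ := exists_avoid G hδ hnotbook u v hadj
        exact ⟨e, ⟨he, by tauto⟩, ⟨he, by tauto⟩⟩
      · obtain ⟨d, hd, hvd⟩ := exists_other G hδ v u
        intro hs
        have := (hs (a := s(v, d)) ⟨hvd, by simp [hu, huv, hd.symm]⟩).2
        simp [hv] at this
      · obtain ⟨d, hd, hvd⟩ := exists_other G hδ u v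
        intro hs
        have := (hs (a := s(u, d)) ⟨hvd, by simp [hv, huv.symm, hd.symm]⟩).2
        simp [hu] at this
    · exact rep_end G hδ hnotbook x y u v hu hv
  · by_cases hv : v = x ∨ v = y
    · rw [G.adj_comm, Ov.symm_iff]
      exact rep_end G hδ hnotbook x y v u hv hu
    · have key : ∀ u v, u ≠ v → ¬ (u = x ∨ u = y) → ¬ (v = x ∨ v = y) →
          ¬ rep G x y u ⊆ rep G x y v := by
        intro u v huv hu hv hs
        obtain ⟨d, hd, hvd⟩ := exists_other G hδ u v
        have := (hs (a := s(u, d)) ⟨hvd, by simp [hu]⟩).2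
        simp [hv, huv.symm, hd.symm] at this
      refine ⟨fun h => ⟨⟨s(u, v), ⟨h, by simp [hu]⟩, ⟨h, by simp [hv]⟩⟩,
        key u v huv hu hv, key v u huv.symm hv hu⟩, ?_⟩
      rintro ⟨⟨e, ⟨he, h1⟩, ⟨-, h2⟩⟩, -⟩
      have : e = s(u, v) := (Sym2.mem_and_mem_iff huv).1 ⟨by tauto, by tauto⟩
      subst this
      exact he

lemma rep_union {V : Type*} (G : SimpleGraph V) (x y : V) (hxy : G.Adj x y) :
    (⋃ v, rep G x y v) = G.edgeSet \ {s(x, y)} := by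
  ext e
  simp only [Set.mem_iUnion, Set.mem_diff, Set.mem_singleton_iff]
  constructor
  · rintro ⟨v, he, hv⟩
    refine ⟨he, ?_⟩
    rintro rfl
    simp at hv
    tauto
  · rintro ⟨he, hne⟩
    by_cases hx : x ∈ e
    · have hy : y ∉ e := fun hy => hne ((Sym2.mem_and_mem_iff hxy.ne).1 ⟨hx, hy⟩)
      exact ⟨y, he, by tauto⟩
    · exact ⟨x, he, by tauto⟩

theorem stmt_13 {V : Type*} [Fintype V] (G : SimpleGraph V)
    (hδ : ∀ v : V, 2 ≤ (G.neighborSet v).ncard)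
    (hnotbook : ¬ Nonempty (G ≃g book (Fintype.card V))) :
    (∃ f : V → Finset ℕ, IsOverlapRep G f ∧ repSize f = G.edgeSet.ncard - 1) ∧
    overlapNumber G ≤ G.edgeSet.ncard - 1 := by
  classical
  suffices h : ∃ f : V → Finset ℕ, IsOverlapRep G f ∧ repSize f = G.edgeSet.ncard - 1 from
    ⟨h, Nat.sInf_le h⟩
  have hne : Nonempty V := by
    by_contra hV
    rw [not_nonempty_iff] at hV
    have h0 : IsEmpty (Fin (Fintype.card V)) := by
      rw [Fintype.card_eq_zero]; infer_instance
    exact hnotbook ⟨⟨Equiv.equivOfIsEmpty _ _, fun {a} => isEmptyElim a⟩⟩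
  obtain ⟨x⟩ := hne
  obtain ⟨y, -, hxy⟩ := exists_other G hδ x x
  let i : Sym2 V → ℕ := fun e => (Fintype.equivFin (Sym2 V) e : ℕ)
  have hi : Function.Injective i := fun a b h =>
    (Fintype.equivFin (Sym2 V)).injective (Fin.ext h)
  let f : V → Finset ℕ := fun v => (Set.toFinite (i '' rep G x y v)).toFinset
  have hf : ∀ v, (f v : Set ℕ) = i '' rep G x y v := fun v => by simp [f]
  refine ⟨f, ?_, ?_⟩
  · intro u v huv
    rw [rep_ov G hδ hnotbook x y u v hxy huv, Ov, ← Finset.coe_nonempty, Finset.coe_inter,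
      ← Finset.coe_subset, ← Finset.coe_subset, hf, hf, ← Set.image_inter hi,
      Set.image_nonempty, Set.image_subset_image_iff hi, Set.image_subset_image_iff hi]
  · unfold repSize
    simp only [hf]
    rw [← Set.image_iUnion, Set.ncard_image_of_injective _ hi, rep_union G x y hxy,
      Set.ncard_diff_singleton_of_mem (by exact hxy)]
end
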